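/- Let n ≥ 2 and let F be a finite field with |F| = q, where (n,q) is none of (2,2), (2,3), (2,5), (2,7), (2,9), (2,11), (4,2). Then every proper subgroup H of PSL_n(F) has index at least (q^n−1)/(q−1); that is, the minimal degree of a faithful permutation representation of PSL_n(F) is (q^n−1)/(q−1). -/

import Mathlib

set_option linter.all false
namespace PSLMin
open Matrix

abbrev SL (n : ℕ) (F : Type*) [Field F] := Matrix.SpecialLinearGroup (Fin n) F

section basics
variable {n : ℕ} {F : Type*} [Field F]

/-- action on vectors -/
def ac (g : SL n F) (x : Fin n → F) : Fin n → F := (g : Matrix (Fin n) (Fin n) F) *ᵥ x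
/-- action on covectors -/
def co (g : SL n F) (φ : Fin n → F) : Fin n → F := φ ᵥ* ((g⁻¹ : SL n F) : Matrix (Fin n) (Fin n) F)

@[simp] lemma ac_one (x : Fin n → F) : ac 1 x = x := by simp [ac]
lemma ac_mul (g h : SL n F) (x : Fin n → F) : ac (g * h) x = ac g (ac h x) := by simp [ac]
lemma ac_add (g : SL n F) (x y : Fin n → F) : ac g (x + y) = ac g x + ac g y := by simp [ac, mulVec_add]
lemma ac_sub (g : SL n F) (x y : Fin n → F) : ac g (x - y) = ac g x - ac g y := by simp [ac, mulVec_sub]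
lemma ac_smul (g : SL n F) (c : F) (y : Fin n → F) : ac g (c • y) = c • ac g y := by simp [ac, mulVec_smul]
@[simp] lemma ac_zero (g : SL n F) : ac g 0 = 0 := by simp [ac]
@[simp] lemma ac_inv_ac (g : SL n F) (x : Fin n → F) : ac g⁻¹ (ac g x) = x := by rw [← ac_mul]; simp
@[simp] lemma ac_ac_inv (g : SL n F) (x : Fin n → F) : ac g (ac g⁻¹ x) = x := by rw [← ac_mul]; simp
lemma ac_inj (g : SL n F) {x y : Fin n → F} (h : ac g x = ac g y) : x = y := by
  rw [← ac_inv_ac g x, h, ac_inv_ac]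
lemma ac_eq_iff (g : SL n F) {x y : Fin n → F} : ac g x = ac g y ↔ x = y := ⟨ac_inj g, fun h => h ▸ rfl⟩
lemma ac_eq_zero (g : SL n F) {x : Fin n → F} : ac g x = 0 ↔ x = 0 := by
  conv_lhs => rw [← ac_zero g, ac_eq_iff]

@[simp] lemma co_one (x : Fin n → F) : co 1 x = x := by simp [co]
lemma co_mul (g h : SL n F) (x : Fin n → F) : co (g * h) x = co g (co h x) := by
  rw [co, co, co, _root_.mul_inv_rev, vecMul_vecMul]; rfl
lemma co_add (g : SL n F) (x y : Fin n → F) : co g (x + y) = co g x + co g y := by simp [co, add_vecMul]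
lemma co_sub (g : SL n F) (x y : Fin n → F) : co g (x - y) = co g x - co g y := by simp [co, sub_vecMul]
lemma co_smul (g : SL n F) (c : F) (y : Fin n → F) : co g (c • y) = c • co g y := by simp [co, smul_vecMul]
@[simp] lemma co_zero (g : SL n F) : co g 0 = 0 := by simp [co]
@[simp] lemma co_inv_co (g : SL n F) (x : Fin n → F) : co g⁻¹ (co g x) = x := by rw [← co_mul]; simp
@[simp] lemma co_co_inv (g : SL n F) (x : Fin n → F) : co g (co g⁻¹ x) = x := by rw [← co_mul]; simp
lemma co_inj (g : SL n F) {x y : Fin n → F} (h : co g x = co g y) : x = y := by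
  rw [← co_inv_co g x, h, co_inv_co]

@[simp] lemma co_dot_ac (g : SL n F) (φ x : Fin n → F) : co g φ ⬝ᵥ ac g x = φ ⬝ᵥ x := by
  have : ((g⁻¹ : SL n F) : Matrix (Fin n) (Fin n) F) * (g : Matrix (Fin n) (Fin n) F) = 1 := by
    exact congrArg Subtype.val (inv_mul_cancel g)
  rw [co, ac, ← dotProduct_mulVec, mulVec_mulVec, this, one_mulVec]
lemma co_dot (g : SL n F) (φ x : Fin n → F) : co g φ ⬝ᵥ x = φ ⬝ᵥ ac g⁻¹ x := by
  conv_lhs => rw [← ac_ac_inv g x]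
  rw [co_dot_ac]

lemma sl_ext {g h : SL n F} (H : ∀ x, ac g x = ac h x) : g = h := by
  apply Subtype.ext
  apply Matrix.ext_of_mulVec_single
  intro i
  exact H _

open Classical in
/-- transvection x ↦ x + φ(x) v when φ(v) = 0 -/
noncomputable def tv (v φ : Fin n → F) : SL n F :=
  if h : φ ⬝ᵥ v = 0 then ⟨1 + vecMulVec v φ, by
    rw [vecMulVec_eq Unit, det_one_add_replicateCol_mul_replicateRow, h, add_zero]⟩ else 1

lemma tv_coe {v φ : Fin n → F} (h : φ ⬝ᵥ v = 0) :
    ((tv v φ : SL n F) : Matrix (Fin n) (Fin n) F) = 1 + vecMulVec v φ := by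
  have : tv v φ = (⟨1 + vecMulVec v φ, by
    rw [vecMulVec_eq Unit, det_one_add_replicateCol_mul_replicateRow, h, add_zero]⟩ : SL n F) := by
    unfold tv
    exact dif_pos h
  rw [this]

lemma ac_tv {v φ : Fin n → F} (h : φ ⬝ᵥ v = 0) (x : Fin n → F) :
    ac (tv v φ) x = x + (φ ⬝ᵥ x) • v := by
  simp [ac, tv_coe h, add_mulVec, vecMulVec_mulVec]

lemma tv_of_ne {v φ : Fin n → F} (h : φ ⬝ᵥ v ≠ 0) : tv v φ = 1 := by simp [tv, h]

@[simp] lemma tv_zero (v : Fin n → F) : tv v 0 = 1 := by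
  apply sl_ext; intro x; rw [ac_tv (by simp)]; simp
@[simp] lemma tv_zero' (v : Fin n → F) : tv 0 v = 1 := by
  apply sl_ext; intro x; rw [ac_tv (by simp)]; simp

lemma tv_add {v φ φ' : Fin n → F} (h : φ ⬝ᵥ v = 0) (h' : φ' ⬝ᵥ v = 0) :
    tv v (φ + φ') = tv v φ * tv v φ' := by
  apply sl_ext; intro x
  rw [ac_mul, ac_tv (by simp [h, h']), ac_tv h, ac_tv h']
  simp [add_dotProduct, dotProduct_add, dotProduct_smul, h, add_smul]
  abel

lemma tv_add' {v v' φ : Fin n → F} (h : φ ⬝ᵥ v = 0) (h' : φ ⬝ᵥ v' = 0) :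
    tv (v + v') φ = tv v φ * tv v' φ := by
  apply sl_ext; intro x
  rw [ac_mul, ac_tv (by simp [h, h', dotProduct_add]), ac_tv h, ac_tv h']
  simp [dotProduct_add, dotProduct_smul, h', smul_add]
  abel

lemma tv_smul (a : F) (v φ : Fin n → F) : tv (a • v) φ = tv v (a • φ) := by
  by_cases ha : a = 0
  · simp [ha]
  by_cases h : φ ⬝ᵥ v = 0
  · apply sl_ext; intro x
    rw [ac_tv (by simp [h]), ac_tv (by simp [h])]
    simp [smul_smul, mul_comm]
  · rw [tv_of_ne, tv_of_ne]
    · simp [h, ha]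
    · simp [h, ha]

lemma tv_neg {v φ : Fin n → F} : tv v (-φ) = (tv v φ)⁻¹ := by
  by_cases h : φ ⬝ᵥ v = 0
  · rw [eq_inv_iff_mul_eq_one, ← tv_add (by simp [h]) h]; simp
  · rw [tv_of_ne h, tv_of_ne (by simpa using h)]; simp

lemma conj_tv (g : SL n F) (v φ : Fin n → F) : g * tv v φ * g⁻¹ = tv (ac g v) (co g φ) := by
  by_cases h : φ ⬝ᵥ v = 0
  · apply sl_ext; intro x
    rw [ac_mul, ac_mul, ac_tv h, ac_tv (by simp [h]), ac_add, ac_smul, co_dot]; simp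
  · rw [tv_of_ne h, tv_of_ne (by simpa using h)]; simp

lemma co_tv {v φ : Fin n → F} (h : φ ⬝ᵥ v = 0) (θ : Fin n → F) :
    co (tv v φ) θ = θ - (θ ⬝ᵥ v) • φ := by
  rw [co, ← tv_neg, tv_coe (by simp [h])]
  simp [vecMul_add, vecMul_vecMulVec, sub_eq_add_neg, vecMul_neg]

lemma tv_eq_one {v φ : Fin n → F} (h : φ ⬝ᵥ v = 0) (h1 : tv v φ = 1) (hv : v ≠ 0) : φ = 0 := by
  apply dotProduct_eq_zero
  intro x
  have := ac_tv h x
  rw [h1, ac_one] at this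
  simpa [hv] using this

/-- dual automorphism -/
def du : SL n F →* SL n F where
  toFun g := (g⁻¹).transpose
  map_one' := by
    apply Subtype.ext
    change (((1 : SL n F)⁻¹ : SL n F) : Matrix (Fin n) (Fin n) F)ᵀ = 1
    rw [inv_one]
    exact transpose_one
  map_mul' a b := by
    apply Subtype.ext
    change (((a * b)⁻¹ : SL n F) : Matrix (Fin n) (Fin n) F)ᵀ = ((a⁻¹ : SL n F) : Matrix (Fin n) (Fin n) F)ᵀ * ((b⁻¹ : SL n F) : Matrix (Fin n) (Fin n) F)ᵀ
    rw [_root_.mul_inv_rev, ← transpose_mul]; rfl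

lemma ac_du (g : SL n F) (φ : Fin n → F) : ac (du g) φ = co g φ := by
  change ((g⁻¹ : SL n F) : Matrix (Fin n) (Fin n) F)ᵀ *ᵥ φ = _
  rw [mulVec_transpose]; rfl
lemma du_du (g : SL n F) : du (du g) = g := by
  apply sl_ext
  intro x
  rw [ac_du]
  apply dotProduct_eq
  intro y
  rw [co_dot, ← map_inv, ac_du, dotProduct_comm, co_dot, dotProduct_comm, inv_inv]
lemma co_du (g : SL n F) (φ : Fin n → F) : co (du g) φ = ac g φ := by
  rw [← ac_du, du_du]
lemma du_tv (v φ : Fin n → F) : du (tv v φ) = tv φ (-v) := by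
  by_cases h : φ ⬝ᵥ v = 0
  · apply sl_ext; intro x
    rw [ac_du, co_tv h, ac_tv (by simpa [dotProduct_comm] using h), dotProduct_comm x v]
    simp [sub_eq_add_neg]
  · rw [tv_of_ne h, tv_of_ne (by simpa [dotProduct_comm] using h)]; simp

lemma exists_dual (U : Submodule F (Fin n → F)) {x : Fin n → F} (hx : x ∉ U) :
    ∃ φ : Fin n → F, (∀ u ∈ U, φ ⬝ᵥ u = 0) ∧ φ ⬝ᵥ x = 1 := by
  obtain ⟨f, hf, hU⟩ := Submodule.exists_le_ker_of_notMem hx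
  obtain ⟨φ, rfl⟩ := (dotProductEquiv F (Fin n)).surjective f
  simp only [dotProductEquiv_apply_apply] at hf
  refine ⟨(φ ⬝ᵥ x)⁻¹ • φ, fun u hu => ?_, ?_⟩
  · have : φ ⬝ᵥ u = 0 := by simpa using hU hu
    simp [this]
  · simp [hf]

lemma exists_notMem (U : Submodule F (Fin n → F)) (h : Module.finrank F U < n) : ∃ x, x ∉ U := by
  by_contra hc
  push Not at hc
  have : U = ⊤ := by ext x; simp [hc]
  rw [this] at h; simp at h

lemma exists_ann (U : Submodule F (Fin n → F)) (h : Module.finrank F U < n) :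
    ∃ φ : Fin n → F, φ ≠ 0 ∧ ∀ u ∈ U, φ ⬝ᵥ u = 0 := by
  obtain ⟨x, hx⟩ := exists_notMem U h
  obtain ⟨φ, h1, h2⟩ := exists_dual U hx
  exact ⟨φ, by rintro rfl; simp at h2, h1⟩

lemma finrank_sup_span (U : Submodule F (Fin n → F)) (x : Fin n → F) :
    Module.finrank F ↥(U ⊔ F ∙ x) ≤ Module.finrank F U + 1 := by
  refine (Submodule.finrank_add_le_finrank_add_finrank _ _).trans ?_
  have := finrank_span_le_card (R := F) ({x} : Set (Fin n → F))
  simp at this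
  omega

def gW (W : Submodule F (Fin n → F)) : Subgroup (SL n F) :=
  Subgroup.closure {g | ∃ a φ, φ ⬝ᵥ a = 0 ∧ (∀ u ∈ W, φ ⬝ᵥ u = 0) ∧ g = tv a φ}

lemma gW_fix {W : Submodule F (Fin n → F)} {t : SL n F} (ht : t ∈ gW W) {u : Fin n → F} (hu : u ∈ W) : ac t u = u := by
  induction ht using Subgroup.closure_induction with
  | mem g hg => obtain ⟨a, φ, h1, h2, rfl⟩ := hg; rw [ac_tv h1, h2 u hu]; simp
  | one => simp
  | mul g h _ _ h1 h2 => rw [ac_mul, h2, h1]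
  | inv g _ h => rw [← ac_eq_iff g, h]; simp

lemma trans_step {W : Submodule F (Fin n → F)} {x y : Fin n → F} (h : x ∉ W ⊔ F ∙ (y - x)) :
    ∃ t ∈ gW W, ac t x = y := by
  obtain ⟨φ, h1, h2⟩ := exists_dual _ h
  have h3 : φ ⬝ᵥ (y - x) = 0 := h1 _ (Submodule.mem_sup_right (Submodule.mem_span_singleton_self _))
  refine ⟨tv (y - x) φ, Subgroup.subset_closure ⟨_, _, h3, fun u hu => h1 u (Submodule.mem_sup_left hu), rfl⟩, ?_⟩
  rw [ac_tv h3, h2]; simp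

lemma trans_lemma {W : Submodule F (Fin n → F)} (hW : Module.finrank F W + 2 ≤ n) {x y : Fin n → F}
    (hx : x ∉ W) (hy : y ∉ W) : ∃ t ∈ gW W, ac t x = y := by
  by_cases h : x ∈ W ⊔ F ∙ (y - x)
  swap
  · exact trans_step h
  have hl := finrank_sup_span W (y - x)
  set U := W ⊔ F ∙ (y - x) with hU
  have hWU : W ≤ U := le_sup_left
  have hyx : y - x ∈ U := Submodule.mem_sup_right (Submodule.mem_span_singleton_self _)
  have hyU : y ∈ U := by simpa using U.add_mem hyx h
  obtain ⟨z, hz⟩ := exists_notMem U (by omega)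
  obtain ⟨t, ht, htx⟩ : ∃ t ∈ gW W, ac t x = z := by
    apply trans_step
    intro hc
    obtain ⟨w, hw, c', hc', hwc⟩ := Submodule.mem_sup.1 hc
    obtain ⟨c, rfl⟩ := Submodule.mem_span_singleton.1 hc'
    by_cases hc0 : c = 0
    · apply hx; rw [← hwc]; simpa [hc0] using hw
    · apply hz
      have : z = c⁻¹ • ((1 + c) • x - w) := by
        rw [eq_inv_smul_iff₀ hc0, eq_sub_iff_add_eq, add_smul, one_smul]
        rw [smul_sub] at hwc
        linear_combination (exp := 1) hwc
      rw [this]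
      exact U.smul_mem _ (U.sub_mem (U.smul_mem _ h) (hWU hw))
  obtain ⟨s, hs, hsz⟩ : ∃ t ∈ gW W, ac t z = y := by
    apply trans_step
    intro hc
    obtain ⟨w, hw, c', hc', hwc⟩ := Submodule.mem_sup.1 hc
    obtain ⟨c, rfl⟩ := Submodule.mem_span_singleton.1 hc'
    have e : (1 + c) • z = w + c • y := by
      rw [add_smul, one_smul]; nth_rewrite 1 [← hwc]; rw [smul_sub]; abel
    by_cases hc0 : 1 + c = 0
    · rw [hc0, zero_smul] at e
      have : c = -1 := by linear_combination hc0
      rw [this] at e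
      apply hy
      have : w = y := by simpa [sub_eq_zero, ← sub_eq_add_neg] using e.symm
      rwa [← this]
    · apply hz
      rw [← U.smul_mem_iff hc0, e]
      exact U.add_mem (hWU hw) (U.smul_mem _ hyU)
  exact ⟨s * t, mul_mem hs ht, by rw [ac_mul, htx, hsz]⟩

lemma gen_top (hn : 2 ≤ n) (K : Subgroup (SL n F)) (hK : ∀ v φ : Fin n → F, φ ⬝ᵥ v = 0 → tv v φ ∈ K) : K = ⊤ := by
  have hgW : ∀ W, gW W ≤ K := by
    intro W
    rw [gW, Subgroup.closure_le]
    rintro g ⟨a, φ, h1, -, rfl⟩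
    exact hK _ _ h1
  rw [eq_top_iff]
  rintro g -
  have key : ∀ k, k + 1 ≤ n → ∃ t ∈ K, ∀ i : Fin n, i.1 < k → ac (t * g) (Pi.single i 1) = Pi.single i 1 := by
    intro k
    induction k with
    | zero => intro _; exact ⟨1, one_mem _, by simp⟩
    | succ k ih =>
      intro hk
      obtain ⟨t, ht, hfix⟩ := ih (by omega)
      let W : Submodule F (Fin n → F) := Submodule.span F (Set.range fun i : Fin k => (Pi.single ⟨i.1, by omega⟩ 1 : Fin n → F))
      have hWf : Module.finrank F W ≤ k := by
        have := finrank_range_le_card (R := F) (fun i : Fin k => (Pi.single ⟨i.1, by omega⟩ 1 : Fin n → F))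
        simpa [Set.finrank] using this
      have hWfix : ∀ u ∈ W, ac (t * g) u = u := by
        intro u hu
        induction hu using Submodule.span_induction with
        | mem x hx => obtain ⟨i, rfl⟩ := hx; exact hfix _ i.2
        | zero => simp
        | add x y _ _ h1 h2 => rw [ac_add, h1, h2]
        | smul a x _ h => rw [ac_smul, h]
      have hWk : ∀ u ∈ W, u ⟨k, by omega⟩ = 0 := by
        intro u hu
        induction hu using Submodule.span_induction with
        | mem x hx =>
          obtain ⟨i, rfl⟩ := hx
          apply Pi.single_eq_of_ne
          intro hh
          have := congrArg Fin.val hh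
          have := i.2
          simp at *
          omega
        | zero => simp
        | add x y _ _ h1 h2 => simp [h1, h2]
        | smul a x _ h => simp [h]
      have hy : (Pi.single ⟨k, by omega⟩ 1 : Fin n → F) ∉ W := fun h => by simpa using hWk _ h
      have hx : ac (t * g) (Pi.single ⟨k, by omega⟩ 1 : Fin n → F) ∉ W := fun h => by
        have := hWfix _ h
        rw [ac_eq_iff] at this
        rw [this] at h
        exact hy h
      obtain ⟨s, hs, hsx⟩ := trans_lemma (by omega) hx hy
      refine ⟨s * t, mul_mem (hgW _ hs) ht, fun i hi => ?_⟩
      rw [mul_assoc, ac_mul]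
      rcases Nat.lt_succ_iff_lt_or_eq.1 hi with h | h
      · rw [hfix i h]
        exact gW_fix hs (Submodule.subset_span ⟨⟨i.1, h⟩, rfl⟩)
      · have : i = ⟨k, by omega⟩ := Fin.ext h
        rw [this, hsx]
  obtain ⟨t, ht, hfix⟩ := key (n - 1) (by omega)
  set l : Fin n := ⟨n - 1, by omega⟩
  set a := ac (t * g) (Pi.single l 1) with ha
  have hm : ((t * g : SL n F) : Matrix (Fin n) (Fin n) F) = 1 + vecMulVec (a - Pi.single l 1) (Pi.single l 1) := by
    apply Matrix.ext_of_mulVec_single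
    intro i
    rw [add_mulVec, vecMulVec_mulVec, one_mulVec]
    change ac (t * g) _ = _
    by_cases hi : i.1 < n - 1
    · rw [hfix i hi]
      have : l ≠ i := by rintro rfl; simp [l] at hi
      simp [this]
    · have : i = l := Fin.ext (by simp [l]; omega)
      rw [this, ← ha]
      simp
  have hd : (Pi.single l 1 : Fin n → F) ⬝ᵥ (a - Pi.single l 1) = 0 := by
    have h1 := (t * g).2
    rw [hm, vecMulVec_eq Unit, det_one_add_replicateCol_mul_replicateRow] at h1
    simpa [sub_eq_zero] using h1
  have : t * g = tv (a - Pi.single l 1) (Pi.single l 1) := by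
    apply Subtype.ext
    exact hm.trans (tv_coe hd).symm
  have h2 : g = t⁻¹ * tv (a - Pi.single l 1) (Pi.single l 1) := by rw [← this]; group
  rw [h2]
  exact mul_mem (inv_mem ht) (hK _ _ hd)

end basics
end PSLMin

set_option linter.all false
namespace PSLMin
open Matrix

section chars
variable {n : ℕ} {F : Type*} [Field F] [Fintype F]

/-- x is orthogonal to S through the character -/
def Pp (ψ : AddChar F ℂ) (S : AddSubgroup (Fin n → F)) (x : Fin n → F) : Prop := ∀ φ ∈ S, ψ (φ ⬝ᵥ x) = 1

lemma exists_ne_one {ψ : AddChar F ℂ} (hψ : ψ ≠ 1) {a : F} (ha : a ≠ 0) : ∃ c, ψ (c * a) ≠ 1 := by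
  obtain ⟨b, hb⟩ := (AddChar.ne_one_iff).1 hψ
  exact ⟨b * a⁻¹, by rwa [mul_assoc, inv_mul_cancel₀ ha, mul_one]⟩

open Classical in
lemma card_Pp {ψ : AddChar F ℂ} (hψ : ψ ≠ 1) (S : AddSubgroup (Fin n → F)) :
    Nat.card S * (Finset.univ.filter (fun x => Pp ψ S x)).card = Fintype.card F ^ n := by
  have key : ∑ x : Fin n → F, ∑ φ : S, ψ (φ.1 ⬝ᵥ x) = ((Fintype.card F ^ n : ℕ) : ℂ) := by
    rw [Finset.sum_comm]
    rw [Finset.sum_eq_single (0 : S)]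
    · simp
    · intro φ _ hφ
      let χ : AddChar (Fin n → F) ℂ :=
        { toFun := fun x => ψ (φ.1 ⬝ᵥ x)
          map_zero_eq_one' := by simp
          map_add_eq_mul' := by intro a b; simp [dotProduct_add, AddChar.map_add_eq_mul] }
      apply AddChar.sum_eq_zero_of_ne_one (ψ := χ)
      rw [AddChar.ne_one_iff]
      have : φ.1 ≠ 0 := by simpa using hφ
      obtain ⟨i, hi⟩ := Function.ne_iff.1 this
      obtain ⟨c, hc⟩ := exists_ne_one hψ hi
      refine ⟨Pi.single i c, ?_⟩
      change ψ _ ≠ 1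
      simpa [mul_comm] using hc
    · simp
  have key2 : ∀ x : Fin n → F, ∑ φ : S, ψ (φ.1 ⬝ᵥ x) = if Pp ψ S x then (Nat.card S : ℂ) else 0 := by
    intro x
    let χ : AddChar S ℂ :=
        { toFun := fun φ => ψ (φ.1 ⬝ᵥ x)
          map_zero_eq_one' := by simp
          map_add_eq_mul' := by intro a b; simp [add_dotProduct, AddChar.map_add_eq_mul] }
    split_ifs with h
    · rw [Finset.sum_congr rfl (fun φ _ => h φ.1 φ.2)]
      simp
    · apply AddChar.sum_eq_zero_of_ne_one (ψ := χ)
      rw [AddChar.ne_one_iff]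
      rw [Pp] at h
      push Not at h
      obtain ⟨φ, h1, h2⟩ := h
      exact ⟨⟨φ, h1⟩, h2⟩
  simp_rw [key2] at key
  rw [← Finset.sum_filter, Finset.sum_const, nsmul_eq_mul] at key
  have : (((Finset.univ.filter (fun x => Pp ψ S x)).card * Nat.card S : ℕ) : ℂ) = ((Fintype.card F ^ n : ℕ) : ℂ) := by
    rw [← key]; push_cast; rfl
  have := Nat.cast_injective (R := ℂ) this
  rw [mul_comm]; exact this

lemma exists_sep {ψ : AddChar F ℂ} (hψ : ψ ≠ 1) {S : AddSubgroup (Fin n → F)} {θ : Fin n → F} (hθ : θ ∉ S) :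
    ∃ x, Pp ψ S x ∧ ψ (θ ⬝ᵥ x) ≠ 1 := by
  classical
  by_contra hc
  push Not at hc
  let T := S ⊔ AddSubgroup.zmultiples θ
  have hST : S ≤ T := le_sup_left
  have hθT : θ ∈ T := AddSubgroup.mem_sup_right (AddSubgroup.mem_zmultiples θ)
  have hp : ∀ x, Pp ψ S x → Pp ψ T x := by
    intro x hx
    let K : AddSubgroup (Fin n → F) :=
      { carrier := {φ | ψ (φ ⬝ᵥ x) = 1}
        zero_mem' := by simp
        add_mem' := by intro a b ha hb; simp only [Set.mem_setOf_eq] at *; simp [add_dotProduct, AddChar.map_add_eq_mul, ha, hb]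
        neg_mem' := by intro a ha; simp only [Set.mem_setOf_eq] at *; simp [AddChar.map_neg_eq_inv, ha] }
    have : T ≤ K := by
      apply sup_le
      · intro φ hφ; exact hx φ hφ
      · rw [AddSubgroup.zmultiples_le]; exact hc x hx
    exact fun φ hφ => this hφ
  have h1 := card_Pp hψ S
  have h2 := card_Pp hψ T
  have h3 : (Finset.univ.filter (fun x => Pp ψ S x)).card ≤ (Finset.univ.filter (fun x => Pp ψ T x)).card := by
    apply Finset.card_le_card
    intro x; simp only [Finset.mem_filter_univ]; exact hp x
  have h4 : Nat.card S < Nat.card T := by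
    have : (S : Set (Fin n → F)) ⊂ T := ⟨hST, fun h => hθ (h hθT)⟩
    exact Set.ncard_lt_ncard this (Set.toFinite _)
  have h0 : 0 < Fintype.card F ^ n := by positivity
  have h5 : 0 < (Finset.univ.filter (fun x => Pp ψ S x)).card := Nat.pos_of_ne_zero (by intro h; rw [h] at h1; omega)
  nlinarith [Nat.mul_lt_mul_of_lt_of_le h4 h3 (h5.trans_le h3)]

open Classical in
lemma card_perp {v : Fin n → F} (hv : v ≠ 0) :
    (Finset.univ.filter (fun φ : Fin n → F => φ ⬝ᵥ v = 0)).card * Fintype.card F = Fintype.card F ^ n := by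
  obtain ⟨i, hi⟩ := Function.ne_iff.1 hv
  have h : ∀ c : F, (Finset.univ.filter (fun φ : Fin n → F => φ ⬝ᵥ v = c)).card = (Finset.univ.filter (fun φ : Fin n → F => φ ⬝ᵥ v = 0)).card := by
    intro c
    apply Finset.card_bij' (fun φ _ => φ - Pi.single i (c * (v i)⁻¹)) (fun φ _ => φ + Pi.single i (c * (v i)⁻¹))
    · intro a _; simp
    · intro a _; simp
    · intro a ha; simp at ha hi ⊢; rw [ha]; field_simp; simp
    · intro a ha; simp at ha hi ⊢; rw [ha]; field_simp; simp
  have := Finset.card_eq_sum_card_fiberwise (s := (Finset.univ : Finset (Fin n → F))) (t := (Finset.univ : Finset F)) (f := fun φ => φ ⬝ᵥ v) (fun _ _ => Finset.mem_coe.2 (Finset.mem_univ _))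
  simp_rw [h] at this
  simp at this
  rw [mul_comm, ← this]

lemma card_perp' (hn : 2 ≤ n) {v : Fin n → F} (hv : v ≠ 0) [DecidablePred (fun φ : Fin n → F => φ ⬝ᵥ v = 0)]:
    (Finset.univ.filter (fun φ : Fin n → F => φ ⬝ᵥ v = 0)).card = Fintype.card F ^ (n - 1) := by
  have := card_perp hv
  obtain ⟨k, rfl⟩ : ∃ k, n = k + 1 := ⟨n - 1, by omega⟩
  rw [pow_succ] at this
  rw [Nat.add_sub_cancel]
  convert Nat.eq_of_mul_eq_mul_right Fintype.card_pos this

variable {Ω : Type*} (ρ : SL n F →* Equiv.Perm Ω)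

lemma rho_mul (g h : SL n F) (ω : Ω) : ρ (g * h) ω = ρ g (ρ h ω) := by simp
lemma rho_inv (g : SL n F) {ω ω' : Ω} (h : ρ g ω = ω') : ρ g⁻¹ ω' = ω := by
  rw [← h, ← rho_mul]; simp

/-- stabilizer in the root group of v -/
def Sg (v : Fin n → F) (ω : Ω) : AddSubgroup (Fin n → F) where
  carrier := {φ | φ ⬝ᵥ v = 0 ∧ ρ (tv v φ) ω = ω}
  zero_mem' := by simp
  add_mem' := by
    rintro a b ⟨h1, h2⟩ ⟨h3, h4⟩
    refine ⟨by simp [h1, h3], ?_⟩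
    rw [tv_add h1 h3, rho_mul, h4, h2]
  neg_mem' := by
    rintro a ⟨h1, h2⟩
    refine ⟨by simp [h1], ?_⟩
    rw [tv_neg]; exact rho_inv ρ _ h2

variable {ρ}
lemma mem_Sg {v φ : Fin n → F} {ω : Ω} : φ ∈ Sg ρ v ω ↔ φ ⬝ᵥ v = 0 ∧ ρ (tv v φ) ω = ω := Iff.rfl

lemma mem_Sg_conj (g : SL n F) {v φ : Fin n → F} {ω : Ω} :
    co g φ ∈ Sg ρ (ac g v) (ρ g ω) ↔ φ ∈ Sg ρ v ω := by
  rw [mem_Sg, mem_Sg, ← conj_tv, co_dot_ac, ← rho_mul]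
  simp only [inv_mul_cancel_right, rho_mul, EmbeddingLike.apply_eq_iff_eq]

lemma mem_Sg_smul {a : F} (ha : a ≠ 0) {v φ : Fin n → F} {ω : Ω} :
    φ ∈ Sg ρ (a • v) ω ↔ a • φ ∈ Sg ρ v ω := by
  rw [mem_Sg, mem_Sg, tv_smul]; simp [ha]

lemma card_Sg_conj (g : SL n F) (v : Fin n → F) (ω : Ω) :
    Nat.card (Sg ρ (ac g v) (ρ g ω)) = Nat.card (Sg ρ v ω) := by
  symm
  apply Nat.card_congr
  exact { toFun := fun φ => ⟨co g φ.1, (mem_Sg_conj g).2 φ.2⟩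
          invFun := fun φ => ⟨co g⁻¹ φ.1, by rw [← mem_Sg_conj g]; simpa using φ.2⟩
          left_inv := by intro φ; simp
          right_inv := by intro φ; simp }

lemma card_Sg_smul {a : F} (ha : a ≠ 0) (v : Fin n → F) (ω : Ω) :
    Nat.card (Sg ρ (a • v) ω) = Nat.card (Sg ρ v ω) := by
  apply Nat.card_congr
  exact { toFun := fun φ => ⟨a • φ.1, (mem_Sg_smul ha).1 φ.2⟩
          invFun := fun φ => ⟨a⁻¹ • φ.1, by rw [mem_Sg_smul ha]; simpa [ha] using φ.2⟩
          left_inv := by intro φ; simp [ha]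
          right_inv := by intro φ; simp [ha] }

lemma Pp_conj (ψ : AddChar F ℂ) (g : SL n F) {v x : Fin n → F} {ω : Ω} :
    Pp ψ (Sg ρ (ac g v) (ρ g ω)) (ac g x) ↔ Pp ψ (Sg ρ v ω) x := by
  constructor
  · intro h φ hφ
    rw [← mem_Sg_conj g] at hφ
    simpa using h _ hφ
  · intro h φ hφ
    rw [← co_co_inv g φ] at hφ ⊢
    rw [mem_Sg_conj g] at hφ
    rw [co_dot_ac]
    exact h _ hφ

lemma Pp_smul (ψ : AddChar F ℂ) {a : F} (ha : a ≠ 0) {v x : Fin n → F} {ω : Ω} :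
    Pp ψ (Sg ρ (a • v) ω) x ↔ Pp ψ (Sg ρ v ω) (a⁻¹ • x) := by
  constructor
  · intro h φ hφ
    have := h (a⁻¹ • φ) (by rw [mem_Sg_smul ha]; simpa [ha] using hφ)
    simpa using this
  · intro h φ hφ
    rw [mem_Sg_smul ha] at hφ
    have := h _ hφ
    simpa [ha] using this

lemma Sg_orbit {v φ : Fin n → F} (hφ : φ ⬝ᵥ v = 0) (ω : Ω) : Sg ρ v (ρ (tv v φ) ω) = Sg ρ v ω := by
  ext θ
  rw [mem_Sg, mem_Sg]
  apply and_congr_right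
  intro h
  rw [← rho_mul, ← tv_add h hφ, add_comm, tv_add hφ h, rho_mul, EmbeddingLike.apply_eq_iff_eq]

variable [Fintype Ω]
open Classical in
/-- the orbit of the root group -/
noncomputable def orb (ρ : SL n F →* Equiv.Perm Ω) (v : Fin n → F) (ω : Ω) : Finset Ω :=
  (Finset.univ.filter (fun φ : Fin n → F => φ ⬝ᵥ v = 0)).image (fun φ => ρ (tv v φ) ω)

lemma mem_orb {v : Fin n → F} {ω ω' : Ω} : ω' ∈ orb ρ v ω ↔ ∃ φ, φ ⬝ᵥ v = 0 ∧ ρ (tv v φ) ω = ω' := by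
  classical
  simp [orb]

lemma orb_sum (hn : 2 ≤ n) {v : Fin n → F} (hv : v ≠ 0) (ω : Ω) :
    ∑ ω' ∈ orb ρ v ω, Nat.card (Sg ρ v ω') = Fintype.card F ^ (n - 1) := by
  classical
  rw [← card_perp' hn hv]
  rw [Finset.card_eq_sum_card_fiberwise (t := orb ρ v ω) (f := fun φ => ρ (tv v φ) ω)]
  swap
  · intro φ hφ
    simp at hφ
    rw [Finset.mem_coe, mem_orb]
    exact ⟨φ, hφ, rfl⟩
  apply Finset.sum_congr rfl
  intro ω' hω'
  obtain ⟨φ0, h0, rfl⟩ := mem_orb.1 hω'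
  rw [Sg_orbit h0, Nat.card_eq_fintype_card, ← Finset.card_univ]
  apply Finset.card_bij (fun φ _ => φ.1 + φ0)
  · rintro ⟨φ, hφ⟩ -
    rw [mem_Sg] at hφ
    simp [h0, hφ.1]
    rw [add_comm, tv_add h0 hφ.1, rho_mul, hφ.2]
  · rintro ⟨φ, hφ⟩ - ⟨φ', hφ'⟩ - h
    simpa using h
  · intro φ hφ
    simp at hφ
    refine ⟨⟨φ - φ0, ?_⟩, Finset.mem_univ _, by simp⟩
    rw [mem_Sg]
    have h3 : (φ - φ0) ⬝ᵥ v = 0 := by simp [hφ.1, h0]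
    refine ⟨h3, ?_⟩
    apply (ρ (tv v φ0)).injective
    rw [← rho_mul, ← tv_add h0 h3]
    simpa using hφ.2

open Classical in
/-- weight -/
noncomputable def Bw (ψ : AddChar F ℂ) (ρ : SL n F →* Equiv.Perm Ω) (v x : Fin n → F) : ℕ :=
  ∑ ω : Ω, if Pp ψ (Sg ρ v ω) x then Nat.card (Sg ρ v ω) else 0

lemma Bw_conj (ψ : AddChar F ℂ) (g : SL n F) (v x : Fin n → F) : Bw ψ ρ (ac g v) (ac g x) = Bw ψ ρ v x := by
  classical
  unfold Bw
  rw [← Equiv.sum_comp (ρ g)]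
  simp_rw [Pp_conj, card_Sg_conj]

lemma Bw_smul (ψ : AddChar F ℂ) {a : F} (ha : a ≠ 0) (v x : Fin n → F) : Bw ψ ρ (a • v) x = Bw ψ ρ v (a⁻¹ • x) := by
  classical
  unfold Bw
  simp_rw [Pp_smul ψ ha, card_Sg_smul ha]

lemma Bw_sum {ψ : AddChar F ℂ} (hψ : ψ ≠ 1) (v : Fin n → F) :
    ∑ x, Bw ψ ρ v x = Fintype.card F ^ n * Fintype.card Ω := by
  classical
  unfold Bw
  rw [Finset.sum_comm]
  have : ∀ ω : Ω, (∑ x, if Pp ψ (Sg ρ v ω) x then Nat.card (Sg ρ v ω) else 0) = Fintype.card F ^ n := by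
    intro ω
    rw [← Finset.sum_filter, Finset.sum_const, smul_eq_mul, mul_comm, card_Pp hψ]
  simp_rw [this]
  simp [mul_comm]

lemma Bw_le_of_mem (hn : 2 ≤ n) (ψ : AddChar F ℂ) {v x : Fin n → F} (hv : v ≠ 0) {ω : Ω} (h : Pp ψ (Sg ρ v ω) x) :
    Fintype.card F ^ (n - 1) ≤ Bw ψ ρ v x := by
  classical
  rw [← orb_sum hn hv ω, Bw, ← Finset.sum_filter]
  apply Finset.sum_le_sum_of_subset
  intro ω' hω'
  obtain ⟨φ0, h0, rfl⟩ := mem_orb.1 hω'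
  simp [Sg_orbit h0, h]

lemma Bw_two (hn : 2 ≤ n) (ψ : AddChar F ℂ) {v x : Fin n → F} (hv : v ≠ 0) {ω ω' : Ω} (h : Pp ψ (Sg ρ v ω) x)
    (h' : Pp ψ (Sg ρ v ω') x) (hB : Bw ψ ρ v x < 2 * Fintype.card F ^ (n - 1)) :
    ∃ φ, φ ⬝ᵥ v = 0 ∧ ρ (tv v φ) ω = ω' := by
  classical
  by_contra hc
  have hd : Disjoint (orb ρ v ω) (orb ρ v ω') := by
    rw [Finset.disjoint_left]
    intro a ha hb
    apply hc
    obtain ⟨φ, h1, h2⟩ := mem_orb.1 ha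
    obtain ⟨φ', h1', h2'⟩ := mem_orb.1 hb
    refine ⟨-φ' + φ, by simp [h1, h1'], ?_⟩
    rw [tv_add (by simp [h1']) h1, rho_mul, h2, tv_neg]
    exact rho_inv ρ _ h2'
  apply absurd hB
  push Not
  have : 2 * Fintype.card F ^ (n - 1) = ∑ a ∈ orb ρ v ω ∪ orb ρ v ω', Nat.card (Sg ρ v a) := by
    rw [Finset.sum_union hd, orb_sum hn hv, orb_sum hn hv, two_mul]
  rw [this, Bw, ← Finset.sum_filter]
  apply Finset.sum_le_sum_of_subset
  intro a ha
  rcases Finset.mem_union.1 ha with ha | ha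
  · obtain ⟨φ0, h0, rfl⟩ := mem_orb.1 ha
    simp [Sg_orbit h0, h]
  · obtain ⟨φ0, h0, rfl⟩ := mem_orb.1 ha
    simp [Sg_orbit h0, h']

lemma Bw_eq_zero {ψ : AddChar F ℂ} {v x : Fin n → F} (hB : Bw ψ ρ v x = 0) (ω : Ω) : ¬ Pp ψ (Sg ρ v ω) x := by
  classical
  intro h
  rw [Bw, Finset.sum_eq_zero_iff] at hB
  have := hB ω (Finset.mem_univ _)
  rw [if_pos h] at this
  have h2 : 0 < Nat.card (Sg ρ v ω) := Nat.card_pos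
  omega

lemma Pp_span {ψ : AddChar F ℂ} {v : Fin n → F} (ω : Ω) (c : F) : Pp ψ (Sg ρ v ω) (c • v) := by
  intro φ hφ
  simp [hφ.1]

lemma Bw_span (ψ : AddChar F ℂ) {v : Fin n → F} (c : F) : Bw ψ ρ v (c • v) = ∑ ω : Ω, Nat.card (Sg ρ v ω) := by
  classical
  unfold Bw
  exact Finset.sum_congr rfl (fun ω _ => if_pos (Pp_span ω c))
end chars
end PSLMin

set_option linter.all false
namespace PSLMin
open Matrix

section big
variable {n : ℕ} {F : Type*} [Field F] [Fintype F] {Ω : Type*} [Fintype Ω] {ρ : SL n F →* Equiv.Perm Ω}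

lemma no_fix (hn : 2 ≤ n) (htr : ∀ ω ω' : Ω, ∃ g, ρ g ω = ω') (hN2 : 2 ≤ Fintype.card Ω) (ω : Ω)
    (h : ∀ v φ : Fin n → F, v ≠ 0 → φ ≠ 0 → φ ⬝ᵥ v = 0 → ρ (tv v φ) ω = ω) : False := by
  let K : Subgroup (SL n F) :=
    { carrier := {g | ρ g ω = ω}
      one_mem' := by simp
      mul_mem' := by intro a b ha hb; simp only [Set.mem_setOf_eq] at *; rw [rho_mul, hb, ha]
      inv_mem' := by intro a ha; exact rho_inv ρ _ ha }
  have hK : K = ⊤ := gen_top hn K (fun v φ hφ => by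
    change ρ (tv v φ) ω = ω
    by_cases hv : v = 0
    · simp [hv]
    by_cases hp : φ = 0
    · simp [hp]
    exact h v φ hv hp hφ)
  obtain ⟨ω', hω'⟩ := Fintype.exists_ne_of_one_lt_card (by omega : 1 < Fintype.card Ω) ω
  obtain ⟨g, hg⟩ := htr ω ω'
  have : g ∈ K := hK ▸ Subgroup.mem_top g
  exact hω' (hg.symm.trans this)

lemma exists_ac (hn : 2 ≤ n) {v v' : Fin n → F} (hv : v ≠ 0) (hv' : v' ≠ 0) : ∃ g : SL n F, ac g v = v' := by
  obtain ⟨t, -, h⟩ := trans_lemma (W := (⊥ : Submodule F (Fin n → F))) (by simpa using hn) (x := v) (y := v') (by simpa) (by simpa)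
  exact ⟨t, h⟩

lemma finrank_line (v : Fin n → F) : Module.finrank F (F ∙ v) ≤ 1 := by
  have := finrank_span_le_card (R := F) ({v} : Set (Fin n → F))
  simpa using this

lemma finrank_pair (v x : Fin n → F) : Module.finrank F (Submodule.span F {v, x}) ≤ 2 := by
  classical
  have := finrank_span_le_card (R := F) ({v, x} : Set (Fin n → F))
  refine this.trans ?_
  rw [Set.toFinset_card]
  simp only [← Nat.card_eq_fintype_card]
  exact (Set.ncard_insert_le v {x}).trans (by simp)

lemma not_line_of {v x θ : Fin n → F} (h1 : θ ⬝ᵥ v = 0) (h2 : θ ⬝ᵥ x ≠ 0) : x ∉ F ∙ v := by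
  intro h
  obtain ⟨c, rfl⟩ := Submodule.mem_span_singleton.1 h
  simp [h1] at h2

lemma Bw_const (hn : 3 ≤ n) (ψ : AddChar F ℂ) {v x x' : Fin n → F} (hx : x ∉ F ∙ v) (hx' : x' ∉ F ∙ v) :
    Bw ψ ρ v x = Bw ψ ρ v x' := by
  have := finrank_line v
  obtain ⟨t, ht, htx⟩ := trans_lemma (W := F ∙ v) (by omega) hx hx'
  have h := Bw_conj (ρ := ρ) ψ t v x
  rw [htx, gW_fix ht (Submodule.mem_span_singleton_self v)] at h
  exact h.symm

open Classical in
lemma card_line {v : Fin n → F} (hv : v ≠ 0) : (Finset.univ.filter (fun x => x ∈ F ∙ v)).card = Fintype.card F := by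
  rw [← Finset.card_univ]
  symm
  apply Finset.card_bij (fun c _ => c • v)
  · intro c _; simp [Submodule.mem_span_singleton]
  · intro a _ b _ h; exact smul_left_injective F hv h
  · intro x hx
    simp only [Finset.mem_filter_univ, Submodule.mem_span_singleton] at hx
    obtain ⟨a, ha⟩ := hx
    exact ⟨a, Finset.mem_univ _, ha⟩

open Classical in
lemma count_main (hn : 3 ≤ n) {ψ : AddChar F ℂ} (hψ : ψ ≠ 1) {v x : Fin n → F} (hv : v ≠ 0) (hx : x ∉ F ∙ v) :
    Fintype.card F * (∑ ω : Ω, Nat.card (Sg ρ v ω)) + (Fintype.card F ^ n - Fintype.card F) * Bw ψ ρ v x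
      = Fintype.card F ^ n * Fintype.card Ω := by
  rw [← Bw_sum hψ v]
  rw [← Finset.sum_filter_add_sum_filter_not Finset.univ (fun y => y ∈ F ∙ v)]
  congr 1
  · rw [← card_line hv, ← smul_eq_mul, ← Finset.sum_const]
    apply Finset.sum_congr rfl
    intro y hy
    simp only [Finset.mem_filter_univ, Submodule.mem_span_singleton] at hy
    obtain ⟨c, rfl⟩ := hy
    rw [Bw_span]
  · have h1 : (Finset.univ.filter (fun y => ¬ y ∈ F ∙ v)).card = Fintype.card F ^ n - Fintype.card F := by
      have := Finset.card_filter_add_card_filter_not (s := (Finset.univ : Finset (Fin n → F))) (fun y => y ∈ F ∙ v)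
      rw [card_line hv] at this
      simp at this
      omega
    rw [← h1, ← smul_eq_mul, ← Finset.sum_const]
    apply Finset.sum_congr rfl
    intro y hy
    simp only [Finset.mem_filter_univ] at hy
    exact Bw_const hn ψ hx hy

/-- the standing conclusion on single orbits -/
lemma single (hn : 3 ≤ n) {ψ : AddChar F ℂ} (hψ : ψ ≠ 1) (htr : ∀ ω ω' : Ω, ∃ g, ρ g ω = ω')
    (hN2 : 2 ≤ Fintype.card Ω)
    (hN : Fintype.card Ω * (Fintype.card F - 1) + Fintype.card F ≤ Fintype.card F ^ n)
    {v x : Fin n → F} (hv : v ≠ 0) (hx : x ∉ F ∙ v) :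
    (∃ ω, Pp ψ (Sg ρ v ω) x) ∧ Bw ψ ρ v x = Fintype.card F ^ (n - 1) ∧
    ∀ ω ω', Pp ψ (Sg ρ v ω) x → Pp ψ (Sg ρ v ω') x → ∃ φ, φ ⬝ᵥ v = 0 ∧ ρ (tv v φ) ω = ω' := by
  classical
  have hne : Nonempty Ω := Fintype.card_pos_iff.1 (by omega)
  obtain ⟨ω0⟩ := hne
  have hq : 1 < Fintype.card F := Fintype.one_lt_card
  have hlt : Bw ψ ρ v x < 2 * Fintype.card F ^ (n - 1) := by
    by_contra hc
    push Not at hc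
    have h1 := count_main (ρ := ρ) hn hψ hv hx
    have h2 : Fintype.card F ^ (n - 1) ≤ ∑ ω : Ω, Nat.card (Sg ρ v ω) := by
      have := Bw_le_of_mem (ρ := ρ) (by omega) ψ hv (Pp_span (ψ := ψ) ω0 0)
      rwa [Bw_span] at this
    obtain ⟨k, rfl⟩ : ∃ k, n = k + 1 := ⟨n - 1, by omega⟩
    rw [Nat.add_sub_cancel] at hc h2
    rw [pow_succ] at h1 hN
    generalize (∑ ω : Ω, Nat.card (Sg ρ v ω)) = B0 at *
    generalize Bw ψ ρ v x = B at *
    generalize Fintype.card Ω = N at *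
    have ha : 1 ≤ Fintype.card F ^ k := Nat.one_le_pow _ _ (by omega)
    generalize Fintype.card F ^ k = a at *
    generalize Fintype.card F = q at *
    have e : a * q - q = (a - 1) * q := by rw [Nat.sub_mul, one_mul]
    rw [e] at h1
    obtain ⟨a, rfl⟩ : ∃ b, a = b + 1 := ⟨a - 1, by omega⟩
    obtain ⟨q, rfl⟩ : ∃ b, q = b + 1 := ⟨q - 1, by omega⟩
    simp only [Nat.add_sub_cancel] at *
    have h3 : B0 + a * B = (a + 1) * N := by
      apply Nat.eq_of_mul_eq_mul_right (show 0 < q + 1 by omega)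
      nlinarith
    have h4 : (a + 1) * (2 * a + 1) ≤ (a + 1) * N := by nlinarith
    have h5 := Nat.le_of_mul_le_mul_left h4 (by omega)
    have h6 : (2 * a + 1) * q ≤ N * q := Nat.mul_le_mul_right _ h5
    have h7 : a ≤ a * q := Nat.le_mul_of_pos_right _ (by omega)
    nlinarith
  have hne : ∃ ω, Pp ψ (Sg ρ v ω) x := by
    by_contra hc
    push Not at hc
    have hB : Bw ψ ρ v x = 0 := by
      rw [Bw, Finset.sum_eq_zero_iff]
      intro ω _
      exact if_neg (hc ω)
    have hall : ∀ ω θ, θ ⬝ᵥ v = 0 → θ ∈ Sg ρ v ω := by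
      intro ω θ hθ
      by_contra hs
      obtain ⟨y, hy1, hy2⟩ := exists_sep hψ hs
      have hyv : y ∉ F ∙ v := not_line_of hθ (by intro h; simp [h] at hy2)
      exact Bw_eq_zero ((Bw_const hn ψ hyv hx).trans hB) ω hy1
    apply no_fix (by omega) htr hN2 ω0
    intro v' φ hv' _ hφ
    obtain ⟨g, rfl⟩ := exists_ac (by omega) hv hv'
    rw [← co_co_inv g φ] at hφ ⊢
    rw [co_dot_ac] at hφ
    rw [← conj_tv, rho_mul, rho_mul, (hall _ _ hφ).2, ← rho_mul]
    simp
  refine ⟨hne, ?_, fun ω ω' h h' => Bw_two (by omega) ψ hv h h' hlt⟩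
  obtain ⟨ω, hω⟩ := hne
  apply le_antisymm
  · rw [← orb_sum (by omega) hv ω, Bw, ← Finset.sum_filter]
    apply Finset.sum_le_sum_of_subset
    intro ω' hω'
    rw [mem_orb]
    exact Bw_two (by omega) ψ hv hω (by simpa using hω') hlt
  · exact Bw_le_of_mem (by omega) ψ hv hω

lemma stepA {ψ : AddChar F ℂ} {v z : Fin n → F} 
    (horb : ∀ ω ω', Pp ψ (Sg ρ v ω) z → Pp ψ (Sg ρ v ω') z → ∃ φ, φ ⬝ᵥ v = 0 ∧ ρ (tv v φ) ω = ω')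
    {ω : Ω} (hω : Pp ψ (Sg ρ v ω) z) {φ θ : Fin n → F} (hφ : φ ∈ Sg ρ v ω) (hφ0 : φ ≠ 0)
    (h1 : θ ⬝ᵥ v = 0) (h2 : θ ⬝ᵥ z = 0) (h3 : θ ∉ F ∙ φ) : θ ∈ Sg ρ v ω := by
  have h4 : φ ∉ F ∙ θ := by
    intro h
    obtain ⟨c, hc⟩ := Submodule.mem_span_singleton.1 h
    have hc0 : c ≠ 0 := by rintro rfl; simp at hc; exact hφ0 hc.symm
    apply h3
    rw [Submodule.mem_span_singleton]
    exact ⟨c⁻¹, by rw [← hc, smul_smul, inv_mul_cancel₀ hc0, one_smul]⟩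
  obtain ⟨d, hd1, hd2⟩ := exists_dual _ h4
  have hd1 : θ ⬝ᵥ d = 0 := by
    rw [dotProduct_comm]; exact hd1 _ (Submodule.mem_span_singleton_self _)
  rw [dotProduct_comm] at hd2
  have gv : ac (tv d θ) v = v := by rw [ac_tv hd1, h1]; simp
  have gz : ac (tv d θ) z = z := by rw [ac_tv hd1, h2]; simp
  have h5 := (Pp_conj (ρ := ρ) ψ (tv d θ)).2 hω
  rw [gv, gz] at h5
  obtain ⟨φ', h6, h7⟩ := horb _ _ hω h5
  have h8 := (mem_Sg_conj (ρ := ρ) (tv d θ)).2 hφ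
  rw [gv, ← h7, Sg_orbit h6, co_tv hd1, hd2, one_smul] at h8
  have := sub_mem hφ h8
  simpa using this

lemma claim5 (hn : 3 ≤ n) {ψ : AddChar F ℂ} (hψ : ψ ≠ 1) {v x : Fin n → F} (hv : v ≠ 0) (hx : x ∉ F ∙ v)
    (horb : ∀ z, z ∉ F ∙ v → ∀ ω ω', Pp ψ (Sg ρ v ω) z → Pp ψ (Sg ρ v ω') z → ∃ φ, φ ⬝ᵥ v = 0 ∧ ρ (tv v φ) ω = ω')
    {ω : Ω} (hω : Pp ψ (Sg ρ v ω) x) {φ θ : Fin n → F} (hφ : φ ∈ Sg ρ v ω) (hφ0 : φ ≠ 0)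
    (h1 : θ ⬝ᵥ v = 0) (h2 : θ ⬝ᵥ x = 0) : θ ∈ Sg ρ v ω := by
  by_contra hθ
  have hS : ∀ α ∈ Sg ρ v ω, α ∈ F ∙ θ := by
    intro α hα
    by_cases h0 : α = 0
    · simp [h0]
    by_contra hc
    apply hθ
    apply stepA (horb x hx) hω hα h0 h1 h2
    intro h
    apply hc
    obtain ⟨c, hc⟩ := Submodule.mem_span_singleton.1 h
    have hc0 : c ≠ 0 := by rintro rfl; simp at hc; rw [← hc] at hθ; exact hθ (zero_mem _)
    rw [Submodule.mem_span_singleton]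
    exact ⟨c⁻¹, by rw [← hc, smul_smul, inv_mul_cancel₀ hc0, one_smul]⟩
  obtain ⟨z, hz1, hz2⟩ := exists_sep hψ hθ
  have hz2 : θ ⬝ᵥ z ≠ 0 := by intro h; simp [h] at hz2
  have hzv : z ∉ F ∙ v := not_line_of h1 hz2
  obtain ⟨η, hη0, hη⟩ := exists_ann (Submodule.span F {v, z}) (by have := finrank_pair v z; omega)
  have hηv : η ⬝ᵥ v = 0 := hη _ (Submodule.subset_span (by simp))
  have hηz : η ⬝ᵥ z = 0 := hη _ (Submodule.subset_span (by simp))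
  have : η ∈ F ∙ θ := by
    by_cases h : η ∈ F ∙ φ
    · obtain ⟨a, rfl⟩ := Submodule.mem_span_singleton.1 h
      exact Submodule.smul_mem _ _ (hS φ hφ)
    · exact hS _ (stepA (horb z hzv) hz1 hφ hφ0 hηv hηz h)
  obtain ⟨b, rfl⟩ := Submodule.mem_span_singleton.1 this
  simp [hz2] at hηz
  simp [hηz] at hη0

def Case1 (ρ : SL n F →* Equiv.Perm Ω) (v : Fin n → F) : Prop :=
  ∀ ω, (∀ φ ∈ Sg ρ v ω, φ = 0) ∨ ∀ φ, φ ⬝ᵥ v = 0 → φ ∈ Sg ρ v ω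
def Case2 (ρ : SL n F →* Equiv.Perm Ω) (v : Fin n → F) : Prop :=
  ∀ ω, (∃ x, x ∉ F ∙ v ∧ ∀ θ, θ ⬝ᵥ v = 0 → θ ⬝ᵥ x = 0 → θ ∈ Sg ρ v ω) ∧ ∃ θ, θ ⬝ᵥ v = 0 ∧ θ ∉ Sg ρ v ω

lemma cases (hn : 3 ≤ n) {ψ : AddChar F ℂ} (hψ : ψ ≠ 1) (htr : ∀ ω ω' : Ω, ∃ g, ρ g ω = ω')
    (hN2 : 2 ≤ Fintype.card Ω)
    (hN : Fintype.card Ω * (Fintype.card F - 1) + Fintype.card F ≤ Fintype.card F ^ n)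
    {v : Fin n → F} (hv : v ≠ 0) : Case1 ρ v ∨ Case2 ρ v := by
  classical
  have hs := fun x (hx : x ∉ F ∙ v) => single (ρ := ρ) hn hψ htr hN2 hN hv hx
  have sep : ∀ ω θ, θ ⬝ᵥ v = 0 → θ ∉ Sg ρ v ω → ∃ x, x ∉ F ∙ v ∧ Pp ψ (Sg ρ v ω) x := by
    intro ω θ h1 h2
    obtain ⟨x, hx, hx2⟩ := exists_sep hψ h2
    exact ⟨x, not_line_of h1 (by intro h; simp [h] at hx2), hx⟩
  by_cases h0 : ∃ ω0, ∀ φ ∈ Sg ρ v ω0, φ = 0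
  · left
    obtain ⟨ω0, h0⟩ := h0
    intro ω
    by_cases hf : ∀ φ, φ ⬝ᵥ v = 0 → φ ∈ Sg ρ v ω
    · exact Or.inr hf
    left
    push Not at hf
    obtain ⟨θ, hθ1, hθ2⟩ := hf
    obtain ⟨x, hx1, hx2⟩ := sep ω θ hθ1 hθ2
    obtain ⟨φ, hφ, he⟩ := (hs x hx1).2.2 ω0 ω (by intro φ hφ; rw [h0 φ hφ]; simp) hx2
    rw [← he, Sg_orbit hφ]; exact h0
  · right
    push Not at h0
    have hM : ∀ ω x, x ∉ F ∙ v → Pp ψ (Sg ρ v ω) x → ∀ θ, θ ⬝ᵥ v = 0 → θ ⬝ᵥ x = 0 → θ ∈ Sg ρ v ω := by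
      intro ω x hx hp θ h1 h2
      obtain ⟨φ, hφ, hφ0⟩ := h0 ω
      exact claim5 hn hψ hv hx (fun z hz => (hs z hz).2.2) hp hφ hφ0 h1 h2
    suffices hnf : ∀ ω, ∃ θ, θ ⬝ᵥ v = 0 ∧ θ ∉ Sg ρ v ω by
      intro ω
      refine ⟨?_, hnf ω⟩
      obtain ⟨θ, h1, h2⟩ := hnf ω
      obtain ⟨x, hx1, hx2⟩ := sep ω θ h1 h2
      exact ⟨x, hx1, hM ω x hx1 hx2⟩
    by_contra hc
    push Not at hc
    obtain ⟨ωf, hωf⟩ := hc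
    -- counting
    have bound : ∀ ω, (Finset.univ.filter (fun z => ¬ z ∈ F ∙ v ∧ Pp ψ (Sg ρ v ω) z)).card ≤ Fintype.card F ^ 2 - Fintype.card F := by
      intro ω
      by_cases he : ∃ x, x ∉ F ∙ v ∧ Pp ψ (Sg ρ v ω) x
      swap
      · push Not at he
        rw [Finset.filter_false_of_mem]; simp
        intro z _ hz; exact he z hz.1 hz.2
      obtain ⟨x, hx1, hx2⟩ := he
      have hsub : Finset.univ.filter (fun z => Pp ψ (Sg ρ v ω) z) ⊆ (Finset.univ : Finset (F × F)).image (fun p => p.1 • v + p.2 • x) := by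
        intro z hz
        simp only [Finset.mem_filter_univ] at hz
        by_contra hc
        have hz2 : z ∉ Submodule.span F {v, x} := by
          intro h
          obtain ⟨a, b, h⟩ := Submodule.mem_span_pair.1 h
          apply hc
          simp only [Finset.mem_image, Finset.mem_univ, true_and]
          exact ⟨(a, b), h⟩
        obtain ⟨θ, hθ, hθz⟩ := exists_dual _ hz2
        have h1 : θ ⬝ᵥ v = 0 := hθ _ (Submodule.subset_span (by simp))
        have h2 : θ ⬝ᵥ x = 0 := hθ _ (Submodule.subset_span (by simp))
        apply hψ
        ext c
        have := hz (c • θ) (hM ω x hx1 hx2 _ (by simp [h1]) (by simp [h2]))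
        simpa [hθz] using this
      have h1 := (Finset.card_le_card hsub).trans Finset.card_image_le
      rw [Finset.card_univ, Fintype.card_prod, ← sq] at h1
      have h2 := Finset.card_filter_add_card_filter_not (s := Finset.univ.filter (fun z => Pp ψ (Sg ρ v ω) z)) (fun y => y ∈ F ∙ v)
      rw [Finset.filter_filter, Finset.filter_filter] at h2
      have h3 : Finset.univ.filter (fun z => Pp ψ (Sg ρ v ω) z ∧ z ∈ F ∙ v) = Finset.univ.filter (fun z => z ∈ F ∙ v) := by
        apply Finset.filter_congr
        intro z _
        simp only [and_iff_right_iff_imp]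
        intro hz
        obtain ⟨c, rfl⟩ := Submodule.mem_span_singleton.1 hz
        exact Pp_span ω c
      rw [h3, card_line hv] at h2
      simp_rw [and_comm (a := ¬ _)]
      omega
    have boundf : (Finset.univ.filter (fun z => ¬ z ∈ F ∙ v ∧ Pp ψ (Sg ρ v ωf) z)).card = 0 := by
      rw [Finset.card_eq_zero, Finset.filter_false_of_mem]
      rintro z _ ⟨hz1, hz2⟩
      obtain ⟨θ, hθ, hθz⟩ := exists_dual _ hz1
      have h1 : θ ⬝ᵥ v = 0 := hθ _ (Submodule.mem_span_singleton_self _)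
      apply hψ
      ext c
      have := hz2 (c • θ) (hωf _ (by simp [h1]))
      simpa [hθz] using this
    have hT : ∑ z ∈ Finset.univ.filter (fun z => ¬ z ∈ F ∙ v), Bw ψ ρ v z = (Fintype.card F ^ n - Fintype.card F) * Fintype.card F ^ (n - 1) := by
      have h1 : (Finset.univ.filter (fun y => ¬ y ∈ F ∙ v)).card = Fintype.card F ^ n - Fintype.card F := by
        have := Finset.card_filter_add_card_filter_not (s := (Finset.univ : Finset (Fin n → F))) (fun y => y ∈ F ∙ v)
        rw [card_line hv] at this
        simp at this
        omega
      rw [← h1, ← smul_eq_mul, ← Finset.sum_const]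
      apply Finset.sum_congr rfl
      intro y hy
      simp only [Finset.mem_filter_univ] at hy
      exact (hs y hy).2.1
    have hT2 : ∑ z ∈ Finset.univ.filter (fun z => ¬ z ∈ F ∙ v), Bw ψ ρ v z = ∑ ω, (Finset.univ.filter (fun z => ¬ z ∈ F ∙ v ∧ Pp ψ (Sg ρ v ω) z)).card * Nat.card (Sg ρ v ω) := by
      unfold Bw
      rw [Finset.sum_comm]
      apply Finset.sum_congr rfl
      intro ω _
      rw [← Finset.sum_filter, Finset.filter_filter, Finset.sum_const, smul_eq_mul]
    have hfcard : Nat.card (Sg ρ v ωf) = Fintype.card F ^ (n - 1) := by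
      rw [← card_perp' (by omega) hv, Nat.card_eq_fintype_card]
      rw [Fintype.card_of_subtype]
      intro x
      simp only [Finset.mem_filter_univ]
      exact ⟨hωf x, fun h => h.1⟩
    have hT3 : (∑ ω, (Finset.univ.filter (fun z => ¬ z ∈ F ∙ v ∧ Pp ψ (Sg ρ v ω) z)).card * Nat.card (Sg ρ v ω)) + (Fintype.card F ^ 2 - Fintype.card F) * Nat.card (Sg ρ v ωf) ≤ (Fintype.card F ^ 2 - Fintype.card F) * ∑ ω, Nat.card (Sg ρ v ω) := by
      rw [← Finset.add_sum_erase _ _ (Finset.mem_univ ωf), ← Finset.add_sum_erase _ (fun ω => Nat.card (Sg ρ v ω)) (Finset.mem_univ ωf), boundf]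
      rw [zero_mul, zero_add, mul_add, add_comm, Finset.mul_sum]
      gcongr with ω _
      exact bound ω
    obtain ⟨x, hx⟩ := exists_notMem (F ∙ v) (by have := finrank_line v; omega)
    have hm := count_main (ρ := ρ) hn hψ hv hx
    rw [(hs x hx).2.1] at hm
    rw [← hT2, hT, hfcard] at hT3
    have hq : 1 < Fintype.card F := Fintype.one_lt_card
    obtain ⟨k, rfl⟩ : ∃ k, n = k + 1 := ⟨n - 1, by omega⟩
    rw [Nat.add_sub_cancel] at *
    rw [pow_succ] at hm hT3 hN
    generalize (∑ ω : Ω, Nat.card (Sg ρ v ω)) = B0 at *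
    have ha : 1 ≤ Fintype.card F ^ k := Nat.one_le_pow _ _ (by omega)
    clear hT hT2 hfcard bound boundf hs
    generalize Fintype.card F ^ k = a at *
    generalize Fintype.card F = q at *
    generalize Fintype.card Ω = N at *
    have e : a * q - q = (a - 1) * q := by rw [Nat.sub_mul, one_mul]
    have e2 : q ^ 2 - q = (q - 1) * q := by rw [Nat.sub_mul, one_mul, sq]
    rw [e] at hm hT3
    rw [e2] at hT3
    obtain ⟨a, rfl⟩ : ∃ b, a = b + 1 := ⟨a - 1, by omega⟩
    obtain ⟨q, rfl⟩ : ∃ b, q = b + 1 := ⟨q - 1, by omega⟩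
    simp only [Nat.add_sub_cancel] at *
    have i1 : N * q ≤ a * (q + 1) := by nlinarith
    have i2 := Nat.mul_le_mul_left ((a+1)*(q+1)) i1
    have i3 : q * ((q + 1) * B0) + q * (a * (q+1) * (a+1)) ≤ (a+1)*(q+1)*(a*(q+1)) := by
      rw [← mul_add, hm]; nlinarith
    have i4 : 0 < q * (q+1) * (a+1) := Nat.mul_pos (Nat.mul_pos (by omega) (by omega)) (by omega)
    nlinarith
end big
end PSLMin

set_option linter.all false
namespace PSLMin
open Matrix

section big2
variable {n : ℕ} {F : Type*} [Field F] [Fintype F] {Ω : Type*} [Fintype Ω] {ρ : SL n F →* Equiv.Perm Ω}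

def MM (ρ : SL n F →* Equiv.Perm Ω) (ω : Ω) (v x : Fin n → F) : Prop :=
  x ∉ F ∙ v ∧ ∀ θ, θ ⬝ᵥ v = 0 → θ ⬝ᵥ x = 0 → θ ∈ Sg ρ v ω

lemma exists_dual2 {v x y : Fin n → F} (h : ∀ a b : F, a • v + b • x ≠ y) :
    ∃ φ : Fin n → F, φ ⬝ᵥ v = 0 ∧ φ ⬝ᵥ x = 0 ∧ φ ⬝ᵥ y = 1 := by
  have : y ∉ Submodule.span F {v, x} := by
    intro hh
    obtain ⟨a, b, hab⟩ := Submodule.mem_span_pair.1 hh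
    exact h a b hab
  obtain ⟨φ, h1, h2⟩ := exists_dual _ this
  exact ⟨φ, h1 _ (Submodule.subset_span (by simp)), h1 _ (Submodule.subset_span (by simp)), h2⟩

lemma MM_U {ω : Ω} {v x x' : Fin n → F} (hnf : ∃ θ, θ ⬝ᵥ v = 0 ∧ θ ∉ Sg ρ v ω)
    (h : MM ρ ω v x) (h' : MM ρ ω v x') : ∃ a b : F, a • v + b • x = x' := by
  by_contra hc
  push Not at hc
  obtain ⟨α, h1, h2, h3⟩ := exists_dual2 hc
  obtain ⟨θ, hθ1, hθ2⟩ := hnf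
  apply hθ2
  have e : θ = (θ ⬝ᵥ x') • α + (θ - (θ ⬝ᵥ x') • α) := by abel
  rw [e]
  apply add_mem
  · exact h.2 _ (by simp [h1]) (by simp [h2])
  · exact h'.2 _ (by simp [h1, hθ1]) (by simp [h3])

lemma MM_C {ω : Ω} {v x : Fin n → F} (h : MM ρ ω v x) {g : SL n F} (hg : ρ g ω = ω) :
    MM ρ ω (ac g v) (ac g x) := by
  constructor
  · intro hh
    obtain ⟨c, hc⟩ := Submodule.mem_span_singleton.1 hh
    rw [← ac_smul, ac_eq_iff] at hc
    exact h.1 (Submodule.mem_span_singleton.2 ⟨c, hc⟩)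
  · intro θ h1 h2
    rw [← co_co_inv g θ, co_dot_ac] at h1 h2
    have := h.2 _ h1 h2
    rw [← mem_Sg_conj g, hg] at this
    simpa using this

lemma MM_Sp {ω : Ω} {v x x' : Fin n → F} (h : MM ρ ω v x) {a b : F} (he : a • v + b • x = x')
    (hx' : x' ∉ F ∙ v) : MM ρ ω v x' := by
  refine ⟨hx', fun θ h1 h2 => h.2 θ h1 ?_⟩
  have hb : b ≠ 0 := by
    rintro rfl
    apply hx'
    rw [← he, zero_smul, add_zero]
    exact Submodule.smul_mem _ _ (Submodule.mem_span_singleton_self _)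
  rw [← he, dotProduct_add, dotProduct_smul, h1] at h2
  simpa [hb] using h2

lemma notmem_line_iff {v x : Fin n → F} : x ∉ F ∙ v ↔ ∀ c : F, c • v ≠ x := by
  rw [Submodule.mem_span_singleton]; push Not; rfl

lemma MM_step1 {ω : Ω} (hE : ∀ v : Fin n → F, v ≠ 0 → ∃ x, MM ρ ω v x)
    (hnf : ∀ v : Fin n → F, v ≠ 0 → ∃ θ, θ ⬝ᵥ v = 0 ∧ θ ∉ Sg ρ v ω)
    {v x v' : Fin n → F} (hv : v ≠ 0) (h : MM ρ ω v x) {a b : F} (hb : b ≠ 0) (he : a • v + b • x = v') :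
    MM ρ ω v' v := by
  have hxv := notmem_line_iff.1 h.1
  have hv' : v' ≠ 0 := by
    intro h0
    rw [h0] at he
    apply hxv (-(b⁻¹ * a))
    have : x = b⁻¹ • (b • x) := by rw [smul_smul, inv_mul_cancel₀ hb, one_smul]
    rw [this, eq_neg_of_add_eq_zero_right he]
    module
  have hx : x = b⁻¹ • v' - (b⁻¹ * a) • v := by
    rw [← he, smul_add, smul_smul, smul_smul, inv_mul_cancel₀ hb]; module
  have hvv' : v ∉ F ∙ v' := by
    rw [notmem_line_iff]
    intro c hc
    by_cases hc0 : c = 0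
    · rw [hc0, zero_smul] at hc; exact hv hc.symm
    apply hxv (b⁻¹ * c⁻¹ - b⁻¹ * a)
    rw [hx]
    have : v' = c⁻¹ • v := by rw [← hc, smul_smul, inv_mul_cancel₀ hc0, one_smul]
    rw [this]; module
  obtain ⟨x', hx'⟩ := hE v' hv'
  by_cases hc : ∃ c d : F, c • v + d • x = x'
  · obtain ⟨c, d, hcd⟩ := hc
    rw [hx] at hcd
    have hcd' : (c - d * (b⁻¹ * a)) • v + (d * b⁻¹) • v' = x' := by rw [← hcd]; module
    have hk : c - d * (b⁻¹ * a) ≠ 0 := by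
      intro h0
      rw [h0, zero_smul, zero_add] at hcd'
      exact notmem_line_iff.1 hx'.1 _ hcd'
    set k := c - d * (b⁻¹ * a)
    apply MM_Sp hx' (a := -(k⁻¹ * (d * b⁻¹))) (b := k⁻¹) _ hvv'
    rw [← hcd', smul_add, smul_smul, inv_mul_cancel₀ hk]; module
  · push Not at hc
    obtain ⟨φ, h1, h2, h3⟩ := exists_dual2 hc
    have hφ := (h.2 φ h1 h2).2
    have h4 := MM_C hx' hφ
    have h5 : φ ⬝ᵥ v' = 0 := by rw [← he]; simp [dotProduct_add, h1, h2]
    rw [ac_tv h1, ac_tv h1, h3, h5, zero_smul, add_zero, one_smul] at h4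
    obtain ⟨c, d, hcd⟩ := MM_U (hnf v' hv') hx' h4
    apply MM_Sp hx' (a := c) (b := d - 1) _ hvv'
    have : v = (x' + v) - x' := by abel
    rw [this, ← hcd]; module

lemma case2_false (hn : 3 ≤ n) [Nonempty Ω] (h2 : ∀ v : Fin n → F, v ≠ 0 → Case2 ρ v) : False := by
  obtain ⟨ω⟩ := ‹Nonempty Ω›
  have hE : ∀ v : Fin n → F, v ≠ 0 → ∃ x, MM ρ ω v x := fun v hv => (h2 v hv ω).1
  have hnf : ∀ v : Fin n → F, v ≠ 0 → ∃ θ, θ ⬝ᵥ v = 0 ∧ θ ∉ Sg ρ v ω := fun v hv => (h2 v hv ω).2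
  obtain ⟨v, hv⟩ := exists_notMem (⊥ : Submodule F (Fin n → F)) (by simp; omega)
  have hv : v ≠ 0 := by simpa using hv
  obtain ⟨x, hx⟩ := hE v hv
  obtain ⟨y, hy⟩ := exists_notMem (Submodule.span F {v, x}) (by have := finrank_pair v x; omega)
  have hy' : ∀ a b : F, a • v + b • x ≠ y := by
    intro a b hab
    exact hy (Submodule.mem_span_pair.2 ⟨a, b, hab⟩)
  have hy0 : y ≠ 0 := by rintro rfl; exact hy (zero_mem _)
  obtain ⟨φ, h1, h2, h3⟩ := exists_dual2 hy'
  have hφ := (hx.2 φ h1 h2).2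
  obtain ⟨z, hz⟩ := hE y hy0
  have hzy := notmem_line_iff.1 hz.1
  set y' := z - (φ ⬝ᵥ z) • y with hy'def
  have hφy' : φ ⬝ᵥ y' = 0 := by simp [y', dotProduct_sub, h3]
  have m1 : MM ρ ω y y' := by
    apply MM_Sp hz (a := -(φ ⬝ᵥ z)) (b := 1)
    · rw [hy'def]; module
    · rw [notmem_line_iff]
      intro c hc
      apply hzy (c + φ ⬝ᵥ z)
      rw [add_smul, hc, hy'def]; module
  have m2 : MM ρ ω y' y := MM_step1 hE hnf hy0 m1 (a := 0) (b := 1) one_ne_zero (by module)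
  have hy'0 : y' ≠ 0 := by
    intro h
    apply m1.1; rw [h]; exact zero_mem _
  have m3 := MM_C m2 hφ
  rw [ac_tv h1, ac_tv h1, h3, hφy', zero_smul, add_zero, one_smul] at m3
  obtain ⟨c, d, hcd⟩ := MM_U (hnf y' hy'0) m2 m3
  have hvv : (d - 1) • y + c • y' = v := by
    have : v = (y + v) - y := by abel
    rw [this, ← hcd]; module
  have hc : c ≠ 0 := by
    rintro rfl
    rw [zero_smul, add_zero] at hvv
    have hd : d - 1 ≠ 0 := by intro h; rw [h, zero_smul] at hvv; exact hv hvv.symm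
    apply hy' (d - 1)⁻¹ 0
    rw [← hvv, smul_smul, inv_mul_cancel₀ hd]; module
  have m4 := MM_step1 hE hnf hy0 m1 hc hvv
  obtain ⟨a, b, hab⟩ := MM_U (hnf v hv) hx m4
  exact hy' a b hab

lemma Case2_conj {v : Fin n → F} (h : Case2 ρ v) (g : SL n F) : Case2 ρ (ac g v) := by
  intro ω
  obtain ⟨⟨x, hx1, hx2⟩, θ, h1, h2⟩ := h (ρ g⁻¹ ω)
  have hω : ρ g (ρ g⁻¹ ω) = ω := by rw [← rho_mul]; simp
  refine ⟨⟨ac g x, ?_, ?_⟩, co g θ, by simpa using h1, ?_⟩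
  · rw [notmem_line_iff] at *
    intro c hc
    rw [← ac_smul, ac_eq_iff] at hc
    exact hx1 c hc
  · intro η h3 h4
    rw [← co_co_inv g η, co_dot_ac] at h3 h4
    have := hx2 _ h3 h4
    rw [← mem_Sg_conj g, hω] at this
    simpa using this
  · rw [← mem_Sg_conj g, hω] at h2
    exact h2

lemma all_case1 (hn : 3 ≤ n) {ψ : AddChar F ℂ} (hψ : ψ ≠ 1) (htr : ∀ ω ω' : Ω, ∃ g, ρ g ω = ω')
    (hN2 : 2 ≤ Fintype.card Ω)
    (hN : Fintype.card Ω * (Fintype.card F - 1) + Fintype.card F ≤ Fintype.card F ^ n)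
    {v : Fin n → F} (hv : v ≠ 0) : Case1 ρ v := by
  have hne : Nonempty Ω := Fintype.card_pos_iff.1 (by omega)
  rcases cases (ρ := ρ) hn hψ htr hN2 hN hv with h | h
  · exact h
  · exfalso
    apply case2_false (ρ := ρ) hn
    intro v' hv'
    obtain ⟨g, rfl⟩ := exists_ac (by omega) hv hv'
    exact Case2_conj h g

lemma regular (hn : 3 ≤ n) {ψ : AddChar F ℂ} (hψ : ψ ≠ 1) (htr : ∀ ω ω' : Ω, ∃ g, ρ g ω = ω')
    (hN2 : 2 ≤ Fintype.card Ω)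
    (hN : Fintype.card Ω * (Fintype.card F - 1) + Fintype.card F ≤ Fintype.card F ^ n) :
    (∀ v φ : Fin n → F, v ≠ 0 → φ ⬝ᵥ v = 0 → ∀ ω, ρ (tv v φ) ω = ω → φ = 0) ∧
    (∀ v : Fin n → F, v ≠ 0 → ∀ ω ω', ∃ φ, φ ⬝ᵥ v = 0 ∧ ρ (tv v φ) ω = ω') := by
  have c1 : ∀ v : Fin n → F, v ≠ 0 → Case1 ρ v := fun v hv => all_case1 hn hψ htr hN2 hN hv
  have c2 : ∀ v : Fin n → F, v ≠ 0 → Case1 (ρ.comp du) v := by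
    intro v hv
    apply all_case1 hn hψ _ hN2 hN hv
    intro ω ω'
    obtain ⟨g, hg⟩ := htr ω ω'
    exact ⟨du g, by simpa [du_du] using hg⟩
  have p1 : ∀ (ω : Ω) (v φ φ' : Fin n → F), v ≠ 0 → φ ≠ 0 → φ ⬝ᵥ v = 0 → φ' ⬝ᵥ v = 0 → ρ (tv v φ) ω = ω → ρ (tv v φ') ω = ω := by
    intro ω v φ φ' hv hφ h1 h2 h3
    rcases c1 v hv ω with h | h
    · exact absurd (h φ ⟨h1, h3⟩) hφ
    · exact (h φ' h2).2
  have p2 : ∀ (ω : Ω) (v φ v' : Fin n → F), v ≠ 0 → φ ≠ 0 → φ ⬝ᵥ v = 0 → φ ⬝ᵥ v' = 0 → ρ (tv v φ) ω = ω → ρ (tv v' φ) ω = ω := by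
    intro ω v φ v' hv hφ h1 h2 h3
    have key : ∀ w, w ∈ Sg (ρ.comp du) φ ω ↔ φ ⬝ᵥ w = 0 ∧ ρ (tv (-w) φ) ω = ω := by
      intro w
      rw [mem_Sg, dotProduct_comm]
      simp only [MonoidHom.comp_apply, du_tv]
      have : tv w (-φ) = tv (-w) φ := by
        have := tv_smul (-1) w φ
        simpa using this.symm
      rw [this]
    rcases c2 φ hφ ω with h | h
    · have := h (-v) ((key _).2 (by simp [h1, h3]))
      simp at this
      exact absurd this hv
    · have := (key _).1 (h (-v') (by rw [dotProduct_comm]; simpa using h2))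
      simpa using this.2
  have r1 : (∀ v φ : Fin n → F, v ≠ 0 → φ ⬝ᵥ v = 0 → ∀ ω, ρ (tv v φ) ω = ω → φ = 0) := by
    intro v φ hv h1 ω h2
    by_contra hφ
    apply no_fix (by omega) htr hN2 ω
    intro v' φ' hv' hφ' h1'
    obtain ⟨η, hη0, hη⟩ := exists_ann (Submodule.span F {v, v'}) (by have := finrank_pair v v'; omega)
    have hηv : η ⬝ᵥ v = 0 := hη _ (Submodule.subset_span (by simp))
    have hηz : η ⬝ᵥ v' = 0 := hη _ (Submodule.subset_span (by simp))
    exact p1 ω v' η φ' hv' hη0 hηz h1' (p2 ω v η v' hv hη0 hηv hηz (p1 ω v φ η hv hφ h1 hηv h2))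
  refine ⟨r1, ?_⟩
  intro v hv ω ω'
  obtain ⟨x, hx⟩ := exists_notMem (F ∙ v) (by have := finrank_line v; omega)
  have hp : ∀ ω, Pp ψ (Sg ρ v ω) x := by
    intro ω φ hφ
    rw [r1 v φ hv hφ.1 ω hφ.2]; simp
  exact (single hn hψ htr hN2 hN hv hx).2.2 ω ω' (hp ω) (hp ω')
end big2
end PSLMin

set_option linter.all false
namespace PSLMin
open Matrix

section nine
variable {n : ℕ} {F : Type*} [Field F]

lemma exists_tor {p p' r r' : Fin n → F} {a b : F} (hab : a * b = 1) (h1 : p' ⬝ᵥ p = 1) (h2 : r' ⬝ᵥ r = 1)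
    (h3 : p' ⬝ᵥ r = 0) : ∃ s : SL n F, ∀ x, ac s x = x + ((b - 1) * (r' ⬝ᵥ x)) • r + ((a - 1) * (p' ⬝ᵥ x)) • p := by
  refine ⟨⟨(1 + vecMulVec ((a - 1) • p) p') * (1 + vecMulVec ((b - 1) • r) r'), ?_⟩, ?_⟩
  · rw [det_mul, vecMulVec_eq Unit, det_one_add_replicateCol_mul_replicateRow, vecMulVec_eq Unit, det_one_add_replicateCol_mul_replicateRow]
    simp [h1, h2, hab]
  · intro x
    change ((1 + vecMulVec ((a - 1) • p) p') * (1 + vecMulVec ((b - 1) • r) r')) *ᵥ x = _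
    rw [← mulVec_mulVec, add_mulVec, one_mulVec, vecMulVec_mulVec, add_mulVec, one_mulVec, vecMulVec_mulVec]
    simp [dotProduct_add, dotProduct_smul, h3]
    rw [smul_smul, smul_smul]
    congr 1
    · rw [mul_comm]
    · rw [mul_comm]

lemma co_eq_of {s : SL n F} {η : Fin n → F} {c d : F} (hcd : c * d = 1) (h : ∀ x, η ⬝ᵥ ac s x = c * (η ⬝ᵥ x)) : co s η = d • η := by
  apply dotProduct_eq
  intro x
  rw [co_dot]
  conv_rhs => rw [← ac_ac_inv s x]
  rw [smul_dotProduct, h, smul_eq_mul]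
  linear_combination (-(η ⬝ᵥ ac s⁻¹ x)) * hcd

lemma ann_indep {U : Submodule F (Fin n → F)} (hU : Module.finrank F U + 2 ≤ n) {η : Fin n → F} (hη : η ≠ 0)
    (h : ∀ u ∈ U, η ⬝ᵥ u = 0) : ∃ η' : Fin n → F, (∀ u ∈ U, η' ⬝ᵥ u = 0) ∧ η' ∉ F ∙ η := by
  have h0 : η ∉ (⊥ : Submodule F (Fin n → F)) := by simpa
  obtain ⟨y, -, hy⟩ := exists_dual _ h0
  rw [dotProduct_comm] at hy
  obtain ⟨z, hz⟩ := exists_notMem (U ⊔ F ∙ y) (by have := finrank_sup_span U y; omega)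
  have hz' : z - (η ⬝ᵥ z) • y ∉ U := by
    intro hh
    apply hz
    have : z = (z - (η ⬝ᵥ z) • y) + (η ⬝ᵥ z) • y := by abel
    rw [this]
    exact add_mem (Submodule.mem_sup_left hh) (Submodule.mem_sup_right (Submodule.smul_mem _ _ (Submodule.mem_span_singleton_self _)))
  obtain ⟨η', h1, h2⟩ := exists_dual _ hz'
  refine ⟨η', h1, fun hh => ?_⟩
  obtain ⟨c, rfl⟩ := Submodule.mem_span_singleton.1 hh
  simp [dotProduct_sub, hy] at h2
  rw [mul_comm, sub_self] at h2
  exact zero_ne_one h2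

variable [Fintype F] {Ω : Type*} {ρ : SL n F →* Equiv.Perm Ω}

def PP (ρ : SL n F →* Equiv.Perm Ω) (ω : Ω) (v w η f : Fin n → F) : Prop :=
  f ⬝ᵥ v = 0 ∧ ρ (tv w η * tv v f) ω = ω

lemma fix_of_eq {ω : Ω} {g h t : SL n F} (e : g = h * t) (hg : ρ g ω = ω) (hh : ρ h ω = ω) : ρ t ω = ω := by
  have : t = h⁻¹ * g := by rw [e]; group
  rw [this, rho_mul, hg]; exact rho_inv ρ _ hh

lemma fix_mul {ω : Ω} {g h : SL n F} (hg : ρ g ω = ω) (hh : ρ h ω = ω) : ρ (g * h) ω = ω := by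
  rw [rho_mul, hh, hg]

lemma ac_h {v w η f : Fin n → F} (h1 : η ⬝ᵥ v = 0) (h2 : η ⬝ᵥ w = 0) (h3 : f ⬝ᵥ v = 0) (x : Fin n → F) :
    ac (tv w η * tv v f) x = x + (f ⬝ᵥ x) • v + (η ⬝ᵥ x) • w := by
  rw [ac_mul, ac_tv h3, ac_tv h2]
  simp [dotProduct_add, h1]

lemma PP_comm (R1 : ∀ v φ : Fin n → F, v ≠ 0 → φ ⬝ᵥ v = 0 → ∀ ω, ρ (tv v φ) ω = ω → φ = 0)
    {ω : Ω} {v w w' η η' f f' : Fin n → F} (hv : v ≠ 0) (h : PP ρ ω v w η f) (h' : PP ρ ω v w' η' f')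
    (a1 : η ⬝ᵥ v = 0) (a2 : η ⬝ᵥ w = 0) (a3 : η ⬝ᵥ w' = 0) (b1 : η' ⬝ᵥ v = 0) (b2 : η' ⬝ᵥ w = 0) (b3 : η' ⬝ᵥ w' = 0) :
    (f ⬝ᵥ w') • η' = (f' ⬝ᵥ w) • η := by
  rw [← sub_eq_zero]
  have hd : ((f ⬝ᵥ w') • η' - (f' ⬝ᵥ w) • η) ⬝ᵥ v = 0 := by simp [a1, b1]
  apply R1 v _ hv hd ω
  refine fix_of_eq ?_ (fix_mul h.2 h'.2) (fix_mul h'.2 h.2)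
  apply sl_ext
  intro x
  simp only [ac_mul _ (tv v ((f ⬝ᵥ w') • η' - (f' ⬝ᵥ w) • η)), ac_mul (tv w η * tv v f) (tv w' η' * tv v f'), ac_mul (tv w' η' * tv v f') (tv w η * tv v f), ac_tv hd, ac_h a1 a2 h.1, ac_h b1 b3 h'.1]
  simp only [dotProduct_add, dotProduct_smul, sub_dotProduct, smul_dotProduct, a1, a2, a3, b1, b2, b3, h.1, h'.1, smul_eq_mul]
  module

lemma PP_uniq (R1 : ∀ v φ : Fin n → F, v ≠ 0 → φ ⬝ᵥ v = 0 → ∀ ω, ρ (tv v φ) ω = ω → φ = 0)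
    {ω : Ω} {v w η f f' : Fin n → F} (hv : v ≠ 0) (h : PP ρ ω v w η f) (h' : PP ρ ω v w η f') : f = f' := by
  have hd : (f - f') ⬝ᵥ v = 0 := by simp [h.1, h'.1]
  rw [← sub_eq_zero]
  apply R1 v _ hv hd ω
  refine fix_of_eq ?_ h.2 h'.2
  rw [mul_assoc, ← tv_add h'.1 hd]
  simp

lemma PP_add {ω : Ω} {v w w' η f f' : Fin n → F} (h : PP ρ ω v w η f) (h' : PP ρ ω v w' η f')
    (a1 : η ⬝ᵥ v = 0) (a2 : η ⬝ᵥ w = 0) (a3 : η ⬝ᵥ w' = 0) :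
    PP ρ ω v (w + w') η (f + f' + (f ⬝ᵥ w') • η) := by
  have hd : (f + f' + (f ⬝ᵥ w') • η) ⬝ᵥ v = 0 := by simp [a1, h.1, h'.1]
  refine ⟨hd, ?_⟩
  convert fix_mul h.2 h'.2 using 2
  congr 1
  apply sl_ext
  intro x
  rw [ac_h a1 (by simp [dotProduct_add, a2, a3]) hd, ac_mul (tv w η * tv v f), ac_h a1 a2 h.1, ac_h a1 a3 h'.1]
  simp only [dotProduct_add, dotProduct_smul, add_dotProduct, smul_dotProduct, a1, a2, a3, h.1, h'.1, smul_eq_mul]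
  module

lemma PP_tor (R1 : ∀ v φ : Fin n → F, v ≠ 0 → φ ⬝ᵥ v = 0 → ∀ ω, ρ (tv v φ) ω = ω → φ = 0)
    (R2 : ∀ v : Fin n → F, v ≠ 0 → ∀ ω ω', ∃ φ, φ ⬝ᵥ v = 0 ∧ ρ (tv v φ) ω = ω')
    {ω : Ω} {v w η f : Fin n → F} (hv : v ≠ 0) (h : PP ρ ω v w η f)
    (a1 : η ⬝ᵥ v = 0) (a2 : η ⬝ᵥ w = 0) {s : SL n F} {a : F} (ha : a ≠ 0) (hs1 : ac s v = a • v)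
    (hs2 : tv (ac s w) (co s η) = tv w η) {y : Fin n → F} (hy : η ⬝ᵥ y = 0) :
    f ⬝ᵥ ac s y = a * (f ⬝ᵥ y) := by
  obtain ⟨σ, hσ1, hσ2⟩ := R2 v hv ω (ρ s⁻¹ ω)
  have ht : ρ (s * tv v σ) ω = ω := by rw [rho_mul, hσ2, ← rho_mul]; simp
  have hd : (a • (co s f + (σ ⬝ᵥ w) • co s η)) ⬝ᵥ v = 0 := by
    have e : v = a⁻¹ • ac s v := by rw [hs1, smul_smul, inv_mul_cancel₀ ha, one_smul]
    rw [e]; simp [add_dotProduct, h.1, a1]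
  have h2 : PP ρ ω v w η (a • (co s f + (σ ⬝ᵥ w) • co s η)) := by
    refine ⟨hd, ?_⟩
    have h3 : ρ ((s * tv v σ) * (tv w η * tv v f) * (s * tv v σ)⁻¹) ω = ω :=
      fix_mul (fix_mul ht h.2) (rho_inv ρ _ ht)
    convert h3 using 2
    congr 1
    have e1 : (s * tv v σ) * (tv w η * tv v f) * (s * tv v σ)⁻¹ =
      s * (((tv v σ) * tv w η * (tv v σ)⁻¹) * ((tv v σ) * tv v f * (tv v σ)⁻¹)) * s⁻¹ := by group
    rw [e1, conj_tv, conj_tv, ac_tv hσ1, ac_tv hσ1, co_tv hσ1, co_tv hσ1, hσ1, h.1, a1]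
    simp only [zero_smul, add_zero, sub_zero]
    rw [tv_add' a2 (by simp [a1]), tv_smul, mul_assoc (tv w η), ← tv_add (by simp [a1]) h.1]
    have e2 : s * (tv w η * tv v ((σ ⬝ᵥ w) • η + f)) * s⁻¹ = (s * tv w η * s⁻¹) * (s * tv v ((σ ⬝ᵥ w) • η + f) * s⁻¹) := by group
    rw [e2, conj_tv, conj_tv, hs2, hs1, tv_smul, co_add, co_smul, add_comm]
  have h4 := PP_uniq R1 hv h h2
  conv_lhs => rw [h4]
  simp [add_dotProduct, hy]

lemma nine (hn : 3 ≤ n) (hexc : ¬ (n = 4 ∧ Fintype.card F = 2)) [Nonempty Ω]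
    (R1 : ∀ v φ : Fin n → F, v ≠ 0 → φ ⬝ᵥ v = 0 → ∀ ω, ρ (tv v φ) ω = ω → φ = 0)
    (R2 : ∀ v : Fin n → F, v ≠ 0 → ∀ ω ω', ∃ φ, φ ⬝ᵥ v = 0 ∧ ρ (tv v φ) ω = ω') : False := by
  classical
  obtain ⟨ω⟩ := ‹Nonempty Ω›
  obtain ⟨v, hv⟩ := exists_notMem (⊥ : Submodule F (Fin n → F)) (by simp; omega)
  have hv : v ≠ 0 := by simpa using hv
  obtain ⟨w, hw⟩ := exists_notMem (F ∙ v) (by have := finrank_line v; omega)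
  have hw' := notmem_line_iff.1 hw
  obtain ⟨η, hη0, hη⟩ := exists_ann (Submodule.span F {v, w}) (by have := finrank_pair v w; omega)
  have hηv : η ⬝ᵥ v = 0 := hη _ (Submodule.subset_span (by simp))
  have hηw : η ⬝ᵥ w = 0 := hη _ (Submodule.subset_span (by simp))
  have hex : ∀ w η : Fin n → F, ∃ f, PP ρ ω v w η f := by
    intro w η
    obtain ⟨f, h1, h2⟩ := R2 v hv ω (ρ (tv w η)⁻¹ ω)
    exact ⟨f, h1, by rw [rho_mul, h2, ← rho_mul]; simp⟩
  obtain ⟨f, hf⟩ := hex w η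
  obtain ⟨y, -, hy⟩ := exists_dual (⊥ : Submodule F (Fin n → F)) (x := η) (by simpa)
  rw [dotProduct_comm] at hy
  -- it suffices to show that f vanishes on ker η
  suffices hker : ∀ w', η ⬝ᵥ w' = 0 → f ⬝ᵥ w' = 0 by
    have hfe : f = (f ⬝ᵥ y) • η := by
      apply dotProduct_eq
      intro x
      have := hker (x - (η ⬝ᵥ x) • y) (by simp [dotProduct_sub, hy])
      simp [dotProduct_sub] at this
      simp
      linear_combination this
    have h2 := hf.2
    rw [hfe, ← tv_smul, ← tv_add' hηw (by simp [hηv])] at h2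
    apply hη0
    apply R1 (w + (f ⬝ᵥ y) • v) η _ (by simp [dotProduct_add, hηw, hηv]) ω h2
    intro h0
    apply hw' (-(f ⬝ᵥ y))
    rw [neg_smul]
    exact (eq_neg_of_add_eq_zero_left h0).symm
  -- commutator argument
  have comm : ∀ w η f w', η ≠ 0 → PP ρ ω v w η f → η ⬝ᵥ v = 0 → η ⬝ᵥ w = 0 → η ⬝ᵥ w' = 0 →
      Module.finrank F ↥(Submodule.span F {v, w} ⊔ F ∙ w') + 2 ≤ n → f ⬝ᵥ w' = 0 := by
    intro w η f w' h0 hf h1 h2 h3 hr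
    obtain ⟨η', h4, h5⟩ := ann_indep hr h0 (by
      intro u hu
      obtain ⟨a, ha, b, hb, rfl⟩ := Submodule.mem_sup.1 hu
      obtain ⟨c, d, rfl⟩ := Submodule.mem_span_pair.1 ha
      obtain ⟨e, rfl⟩ := Submodule.mem_span_singleton.1 hb
      simp [dotProduct_add, h1, h2, h3])
    have h6 : η' ⬝ᵥ v = 0 := h4 _ (Submodule.mem_sup_left (Submodule.subset_span (by simp)))
    have h7 : η' ⬝ᵥ w = 0 := h4 _ (Submodule.mem_sup_left (Submodule.subset_span (by simp)))
    have h8 : η' ⬝ᵥ w' = 0 := h4 _ (Submodule.mem_sup_right (Submodule.mem_span_singleton_self _))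
    obtain ⟨f', hf'⟩ := hex w' η'
    have h9 := PP_comm R1 hv hf hf' h1 h2 h3 h6 h7 h8
    by_contra hc
    apply h5
    rw [Submodule.mem_span_singleton]
    exact ⟨(f ⬝ᵥ w')⁻¹ * (f' ⬝ᵥ w), by rw [mul_smul, ← h9, smul_smul, inv_mul_cancel₀ hc, one_smul]⟩
  intro w' hw'η
  by_cases hn5 : 5 ≤ n
  · apply comm w η f w' hη0 hf hηv hηw hw'η
    have := finrank_sup_span (Submodule.span F {v, w}) w'
    have := finrank_pair v w
    omega
  by_cases hn4 : n = 4
  · have selfz : ∀ w f, η ⬝ᵥ w = 0 → PP ρ ω v w η f → f ⬝ᵥ w = 0 := by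
      intro w f h1 hf
      apply comm w η f w hη0 hf hηv h1 h1
      have : Submodule.span F {v, w} ⊔ F ∙ w = Submodule.span F {v, w} := by
        apply sup_eq_left.2
        rw [Submodule.span_singleton_le_iff_mem]
        exact Submodule.subset_span (by simp)
      rw [this]
      have := finrank_pair v w
      omega
    by_cases h2 : (2 : F) = 0
    · by_cases hsp : ∃ a b : F, a • v + b • w = w'
      · obtain ⟨a, b, rfl⟩ := hsp
        simp [dotProduct_add, hf.1, selfz w f hηw hf]
      push Not at hsp
      obtain ⟨r', r1, r2, r3⟩ := exists_dual2 hsp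
      have hsp2 : ∀ a b : F, a • w + b • w' ≠ v := by
        intro a b hab
        by_cases hb : b = 0
        · rw [hb, zero_smul, add_zero] at hab
          have ha : a ≠ 0 := by rintro rfl; rw [zero_smul] at hab; exact hv hab.symm
          apply hw' a⁻¹
          rw [← hab, smul_smul, inv_mul_cancel₀ ha, one_smul]
        · apply hsp b⁻¹ (-(b⁻¹ * a))
          rw [← hab, smul_add, smul_smul, smul_smul, inv_mul_cancel₀ hb]
          module
      obtain ⟨p', p1, p2, p3⟩ := exists_dual2 hsp2
      have hq : 2 < Fintype.card F := by
        have : 1 < Fintype.card F := Fintype.one_lt_card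
        have : Fintype.card F ≠ 2 := fun h => hexc ⟨hn4, h⟩
        omega
      obtain ⟨α, hα⟩ : ∃ α : F, α ∉ ({0, 1} : Finset F) := by
        classical
        by_contra hc
        push Not at hc
        have : (Finset.univ : Finset F) ⊆ {0, 1} := fun x _ => hc x
        have := Finset.card_le_card this
        have h3 := Finset.card_le_two (a := (0 : F)) (b := 1)
        rw [Finset.card_univ] at this
        omega
      simp only [Finset.mem_insert, Finset.mem_singleton, not_or] at hα
      obtain ⟨hα0, hα1⟩ := hα
      obtain ⟨s, hs⟩ := exists_tor (p := v) (p' := p') (r := w') (r' := r') (inv_mul_cancel₀ hα0) p3 r3 p2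
      have sv : ac s v = α⁻¹ • v := by rw [hs, r1, p3]; module
      have sw : ac s w = w := by rw [hs, r2, p1]; module
      have sw' : ac s w' = α • w' := by rw [hs, r3, p2]; module
      have sη : co s η = η := by
        have := co_eq_of (s := s) (η := η) (c := 1) (d := 1) (by simp) (by
          intro x; rw [hs]; simp [dotProduct_add, hw'η, hηv])
        simpa using this
      have key := PP_tor R1 R2 hv hf hηv hηw (inv_ne_zero hα0) sv (by rw [sw, sη]) hw'η
      rw [sw', dotProduct_smul, smul_eq_mul] at key
      by_contra hne
      have k2 : α * α = 1 := by
        field_simp at key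
        rw [← sq]; exact key
      have k3 : (α - 1) * (α - 1) = 0 := by linear_combination k2 + (1 - α) * h2
      exact hα1 (sub_eq_zero.1 (mul_self_eq_zero.1 k3))
    · obtain ⟨f', hf'⟩ := hex w' η
      have c1 := PP_comm R1 hv hf hf' hηv hηw hw'η hηv hηw hw'η
      have c2 : f ⬝ᵥ w' = f' ⬝ᵥ w := smul_left_injective F hη0 c1
      have c3 := PP_add hf hf' hηv hηw hw'η
      have c4 := selfz _ _ (by simp [dotProduct_add, hηw, hw'η]) c3
      have c5 := selfz w f hηw hf
      have c6 := selfz w' f' hw'η hf'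
      simp only [add_dotProduct, dotProduct_add, smul_dotProduct, c5, c6, hηw, hw'η] at c4
      have : (2 : F) * (f ⬝ᵥ w') = 0 := by
        simp at c4
        linear_combination c4 + c2
      simpa [h2] using this
  · -- n = 3
    have hn3 : n = 3 := by omega
    have hfw : f ⬝ᵥ w = 0 := by
      by_cases h2 : (2 : F) = 0
      · have hd : ((f ⬝ᵥ w) • η) ⬝ᵥ v = 0 := by simp [hηv]
        have h3 : ρ (tv v ((f ⬝ᵥ w) • η)) ω = ω := by
          convert fix_mul hf.2 hf.2 using 2
          congr 1
          apply sl_ext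
          intro x
          rw [ac_mul (tv w η * tv v f), ac_h hηv hηw hf.1, ac_h hηv hηw hf.1, ac_tv hd]
          simp only [dotProduct_add, dotProduct_smul, hf.1, hηv, hηw, smul_dotProduct, smul_eq_mul]
          have e : ∀ z : Fin n → F, z + z = 0 := by
            intro z; rw [← two_smul F z, h2, zero_smul]
          have : x + (f ⬝ᵥ x) • v + (η ⬝ᵥ x) • w + (f ⬝ᵥ x + f ⬝ᵥ x * 0 + η ⬝ᵥ x * f ⬝ᵥ w) • v + (η ⬝ᵥ x + f ⬝ᵥ x * 0 + η ⬝ᵥ x * 0) • w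
            = x + ((f ⬝ᵥ x) • v + (f ⬝ᵥ x) • v) + ((η ⬝ᵥ x) • w + (η ⬝ᵥ x) • w) + (f ⬝ᵥ w * η ⬝ᵥ x) • v := by module
          rw [this, e, e, add_zero, add_zero]
        have := R1 v _ hv hd ω h3
        simpa [hη0] using this
      · have hsp : ∀ a b : F, a • v + b • y ≠ w := by
          intro a b hab
          have : b = 0 := by
            rw [← hab] at hηw
            simpa [dotProduct_add, hηv, hy] using hηw
          rw [this, zero_smul, add_zero] at hab
          exact hw' a hab
        obtain ⟨p', p1, p2, p3⟩ := exists_dual2 hsp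
        obtain ⟨s, hs⟩ := exists_tor (p := w) (p' := p') (r := y) (r' := η) (a := (-1 : F)) (b := -1) (by simp) p3 hy p2
        have sv : ac s v = (1 : F) • v := by rw [hs, hηv, p1]; module
        have sw : ac s w = (-1 : F) • w := by rw [hs, hηw, p3]; module
        have sη : co s η = (-1 : F) • η := co_eq_of (s := s) (η := η) (c := -1) (d := -1) (by simp) (by
            intro x; rw [hs]; simp [dotProduct_add, hy, hηw]; ring)
        have key := PP_tor R1 R2 hv hf hηv hηw one_ne_zero sv (by rw [sw, sη, tv_smul]; simp) hηw
        rw [sw, dotProduct_smul, smul_eq_mul] at key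
        have : (2 : F) * (f ⬝ᵥ w) = 0 := by linear_combination -key
        simpa [h2] using this
    by_cases hsp : ∃ a b : F, a • v + b • w = w'
    · obtain ⟨a, b, rfl⟩ := hsp
      simp [dotProduct_add, hf.1, hfw]
    exfalso
    have l1 : (⊥ : Submodule F (Fin n → F)) < F ∙ v := by
      rw [bot_lt_iff_ne_bot]; simpa using hv
    have l2 : F ∙ v < Submodule.span F {v, w} := by
      rw [SetLike.lt_iff_le_and_exists]
      exact ⟨Submodule.span_mono (by simp), w, Submodule.subset_span (by simp), hw⟩
    have l3 : Submodule.span F {v, w} < Submodule.span F {v, w} ⊔ F ∙ w' := by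
      rw [SetLike.lt_iff_le_and_exists]
      exact ⟨le_sup_left, w', Submodule.mem_sup_right (Submodule.mem_span_singleton_self _), fun h => hsp (Submodule.mem_span_pair.1 h)⟩
    have l4 : Submodule.span F {v, w} ⊔ F ∙ w' < ⊤ := by
      rw [lt_top_iff_ne_top]
      intro h
      have hy' : y ∈ Submodule.span F {v, w} ⊔ F ∙ w' := by rw [h]; trivial
      obtain ⟨a, ha, b, hb, hab⟩ := Submodule.mem_sup.1 hy'
      obtain ⟨c, d, rfl⟩ := Submodule.mem_span_pair.1 ha
      obtain ⟨e, rfl⟩ := Submodule.mem_span_singleton.1 hb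
      rw [← hab] at hy
      simp [dotProduct_add, hηv, hηw, hw'η] at hy
    have m1 := Submodule.finrank_lt_finrank_of_lt l1
    have m2 := Submodule.finrank_lt_finrank_of_lt l2
    have m3 := Submodule.finrank_lt_finrank_of_lt l3
    have m4 := Submodule.finrank_lt_finrank_of_lt l4
    rw [finrank_top, Module.finrank_fin_fun] at m4
    omega
end nine
end PSLMin

set_option linter.all false
namespace PSLMin
open Matrix

section two
variable {F : Type*} [Field F]

lemma quad_card [DecidableEq F] (s : Finset F) {a b c : F} (ha : a ≠ 0) (h : ∀ x ∈ s, a * x ^ 2 + b * x + c = 0) : s.card ≤ 2 := by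
  let p : Polynomial F := Polynomial.C a * Polynomial.X ^ 2 + Polynomial.C b * Polynomial.X + Polynomial.C c
  have hd : p.natDegree = 2 := Polynomial.natDegree_quadratic ha
  have hp : p ≠ 0 := by
    intro h0
    rw [h0] at hd
    simp at hd
  have h1 : s ⊆ p.roots.toFinset := by
    intro x hx
    rw [Multiset.mem_toFinset, Polynomial.mem_roots hp]
    simpa [p] using h x hx
  calc s.card ≤ p.roots.toFinset.card := Finset.card_le_card h1
    _ ≤ Multiset.card p.roots := Multiset.toFinset_card_le _
    _ ≤ p.natDegree := Polynomial.card_roots' p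
    _ = 2 := hd

variable [Fintype F]

lemma nsq_mul {a b : F} (ha : ¬ IsSquare a) (hb : ¬ IsSquare b) : IsSquare (a * b) := by
  classical
  by_cases h : a * b = 0
  · rw [h]; exact IsSquare.zero
  rw [← quadraticChar_neg_one_iff_not_isSquare] at ha hb
  rw [← quadraticChar_one_iff_isSquare h, map_mul, ha, hb]; norm_num

lemma alg_const (h2 : (2 : F) ≠ 0) (W : F → F) (hW : ∀ x, x ≠ 0 → 2 * x * W x = -1)
    (hc : ∀ x c, c ≠ 0 → W (W x + c) = (c⁻¹) ^ 2 * W (x - c⁻¹) - c⁻¹) : Fintype.card F ≤ 5 := by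
  classical
  have key : ∀ x : F, x ∉ ({0, 1, 2⁻¹} : Finset F) → 2 * x ^ 2 + (-2) * x + 1 = 0 := by
    intro x hx
    simp only [Finset.mem_insert, Finset.mem_singleton, not_or] at hx
    obtain ⟨h0, h1, h3⟩ := hx
    have e1 := hW x h0
    have h1' : x - 1 ≠ 0 := sub_ne_zero.2 h1
    have e2 := hW (x - 1) h1'
    have h4 : W x + 1 ≠ 0 := by
      intro h
      apply h3
      have : W x = -1 := by linear_combination h
      rw [this] at e1
      apply eq_inv_of_mul_eq_one_left
      linear_combination -e1
    have e3 := hW _ h4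
    have e4 := hc x 1 one_ne_zero
    simp only [inv_one, one_pow, one_mul] at e4
    rw [e4] at e3
    -- eliminate
    have f1 : 2 * x * (W x + 1) = 2 * x - 1 := by linear_combination e1
    have f2 : 2 * (x - 1) * (W (x - 1) - 1) = 1 - 2 * x := by linear_combination e2
    have : 2 * (x * (x - 1)) * (2 * (W x + 1) * (W (x - 1) - 1)) = - (2 * (x * (x - 1))) := by rw [e3]; ring
    have : (2 * x - 1) * (1 - 2 * x) = - (2 * (x * (x - 1))) := by rw [← this, ← f1, ← f2]; ring
    linear_combination -this
  have h3 := quad_card (Finset.univ \ ({0, 1, 2⁻¹} : Finset F)) h2 (fun x hx => key x (Finset.mem_sdiff.1 hx).2)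
  have h4 := Finset.le_card_sdiff ({0, 1, 2⁻¹} : Finset F) Finset.univ
  have h5 := Finset.card_le_three (a := (0 : F)) (b := 1) (c := 2⁻¹)
  rw [Finset.card_univ] at h4
  omega

lemma alg_two (α β : F) (hα : α ≠ 0) (hβ : β ≠ 0) (hab : α + β = -1) (W γ : F → F) (hγ : ∀ x, γ x = α ∨ γ x = β)
    (hW : ∀ x, x ≠ 0 → x * W x = γ x) (d : F) (hd : ∀ x, W x = -1 → x = d)
    (hc : ∀ x c, c ≠ 0 → W (W x + c) = (c⁻¹) ^ 2 * W (x - c⁻¹) - c⁻¹) : Fintype.card F ≤ 15 := by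
  classical
  have key : ∀ x : F, x ∈ ({0, 1, d} : Finset F) ∪ (Finset.univ.filter (fun x => 1 * x ^ 2 + (-1) * x + (-α) = 0) ∪
      Finset.univ.filter (fun x => 1 * x ^ 2 + (-1) * x + (-β) = 0) ∪
      Finset.univ.filter (fun x => (-β) * x ^ 2 + α * x + α ^ 2 = 0) ∪ Finset.univ.filter (fun x => (-α) * x ^ 2 + β * x + β ^ 2 = 0) ∪
      Finset.univ.filter (fun x => α * x ^ 2 + (-(1 + 3 * α)) * x + (-α ^ 2) = 0) ∪ Finset.univ.filter (fun x => β * x ^ 2 + (-(1 + 3 * β)) * x + (-β ^ 2) = 0)) := by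
    intro x
    rw [Finset.mem_union, or_iff_not_imp_left]
    intro hx
    simp only [Finset.mem_insert, Finset.mem_singleton, not_or] at hx
    obtain ⟨h0, h1, h3⟩ := hx
    have e1 := hW x h0
    have h1' : x - 1 ≠ 0 := sub_ne_zero.2 h1
    have e2 := hW (x - 1) h1'
    have h4 : W x + 1 ≠ 0 := by
      intro h
      apply h3
      apply hd
      linear_combination h
    have e3 := hW _ h4
    have e4 := hc x 1 one_ne_zero
    simp only [inv_one, one_pow, one_mul] at e4
    rw [e4] at e3
    have f1 : x * (W x + 1) = γ x + x := by linear_combination e1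
    have f2 : (x - 1) * (W (x - 1) - 1) = γ (x - 1) + 1 - x := by linear_combination e2
    have f3 : (γ x + x) * (γ (x - 1) + 1 - x) = x * (x - 1) * γ (W x + 1) := by
      rw [← f1, ← f2, ← e3]; ring
    simp only [Finset.mem_union, Finset.mem_filter_univ]
    have hβ' : β = -1 - α := by linear_combination hab
    rcases hγ x with hA | hA <;> rcases hγ (x - 1) with hC | hC <;> rcases hγ (W x + 1) with hB | hB <;>
      rw [hA, hB, hC] at f3
    · refine Or.inl (Or.inl (Or.inl (Or.inl (Or.inl (mul_left_cancel₀ hβ ?_)))))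
      rw [hβ']; linear_combination f3
    · refine Or.inl (Or.inl (Or.inl (Or.inl (Or.inr (mul_left_cancel₀ hα ?_)))))
      rw [hβ'] at f3 ⊢; linear_combination f3
    · refine Or.inl (Or.inl (Or.inl (Or.inr ?_)))
      rw [hβ'] at f3 ⊢; linear_combination -f3
    · refine Or.inl (Or.inr ?_)
      rw [hβ'] at f3; linear_combination f3
    · refine Or.inr ?_
      rw [hβ'] at f3 ⊢; linear_combination f3
    · refine Or.inl (Or.inl (Or.inr ?_))
      rw [hβ'] at f3 ⊢; linear_combination -f3
    · refine Or.inl (Or.inl (Or.inl (Or.inl (Or.inl (mul_left_cancel₀ hβ ?_)))))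
      rw [hβ'] at f3 ⊢; linear_combination f3
    · refine Or.inl (Or.inl (Or.inl (Or.inl (Or.inr (mul_left_cancel₀ hα ?_)))))
      rw [hβ'] at f3 ⊢; linear_combination f3
  have hcard := Finset.card_le_card (fun x _ => key x : (Finset.univ : Finset F) ⊆ _)
  have hq : ∀ a b c : F, a ≠ 0 → (Finset.univ.filter (fun x => a * x ^ 2 + b * x + c = 0)).card ≤ 2 := by
    intro a b c h
    exact quad_card _ h (fun x hx => by simpa using hx)
  have h5 := Finset.card_le_three (a := (0 : F)) (b := 1) (c := d)
  rw [Finset.card_univ] at hcard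
  refine hcard.trans ((Finset.card_union_le _ _).trans ?_)
  have hU : ∀ (s t : Finset F) (k : ℕ), s.card ≤ k → t.card ≤ 2 → (s ∪ t).card ≤ k + 2 := by
    intro s t k h1 h2
    exact (Finset.card_union_le _ _).trans (by omega)
  have h12 := hU _ _ _ (hU _ _ _ (hU _ _ _ (hU _ _ _ (hU _ _ _ (hq 1 (-1) (-α) one_ne_zero) (hq 1 (-1) (-β) one_ne_zero)) (hq (-β) α (α ^ 2) (neg_ne_zero.2 hβ)))
    (hq (-α) β (β ^ 2) (neg_ne_zero.2 hα))) (hq α (-(1 + 3 * α)) (-α ^ 2) hα)) (hq β (-(1 + 3 * β)) (-β ^ 2) hβ)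
  omega

lemma alg (hq : 4 ≤ Fintype.card F) (hq5 : Fintype.card F ≠ 5) (hq7 : Fintype.card F ≠ 7) (hq11 : Fintype.card F ≠ 11)
    (W : F → F) (h0 : W 0 = 0) (hs : ∀ a x, a ≠ 0 → W (a ^ 2 * x) = (a⁻¹) ^ 2 * W x) (hWW : ∀ x, W (W x) = x)
    (hc : ∀ x c, c ≠ 0 → W (W x + c) = (c⁻¹) ^ 2 * W (x - c⁻¹) - c⁻¹) : False := by
  have hd : ∀ c, c ≠ 0 → W c - W (-c) = - c⁻¹ := by
    intro c h
    have e1 := hc 0 c h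
    rw [h0, zero_add, zero_sub] at e1
    have e2 := hs c⁻¹ (-c) (inv_ne_zero h)
    rw [show c⁻¹ ^ 2 * -c = - c⁻¹ by field_simp, inv_inv] at e2
    rw [e1, e2]
    field_simp
    ring
  have h2 : (2 : F) ≠ 0 := by
    intro h
    have := hd 1 one_ne_zero
    have e : (-1 : F) = 1 := by linear_combination -h
    rw [e] at this
    simp at this
  have final : (∀ x, x ≠ 0 → 2 * x * W x = -1) → False := by
    intro h
    have h5 := alg_const h2 W h hc
    have : Fintype.card F = 4 := by omega
    have h3 : Fintype.card F % 2 = 1 := FiniteField.odd_card_of_char_ne_two (by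
      intro hh
      apply h2
      have := ringChar.Nat.cast_ringChar (R := F)
      rw [hh] at this
      exact_mod_cast this)
    omega
  by_cases hi : IsSquare (-1 : F)
  · obtain ⟨i, hi⟩ := hi
    apply final
    intro x hx
    have hi0 : i ≠ 0 := by rintro rfl; simp at hi
    have e1 := hd x hx
    have e2 := hs i x hi0
    rw [show i ^ 2 * x = - x by rw [sq, ← hi]; ring, inv_pow, sq, ← hi] at e2
    rw [e2] at e1
    have : x * x⁻¹ = 1 := mul_inv_cancel₀ hx
    simp at e1
    linear_combination x * e1 - this
  have hcl : ∀ x : F, x ≠ 0 → (∃ s, s ≠ 0 ∧ x = s ^ 2) ∨ (∃ s, s ≠ 0 ∧ x = - s ^ 2) := by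
    intro x hx
    by_cases h : IsSquare x
    · obtain ⟨s, rfl⟩ := h
      exact Or.inl ⟨s, by rintro rfl; simp at hx, (sq s).symm⟩
    · obtain ⟨s, hs⟩ := nsq_mul hi h
      refine Or.inr ⟨s, ?_, by linear_combination -hs⟩
      rintro rfl
      simp [hx] at hs
  have hWs : ∀ s, s ≠ 0 → W (s ^ 2) = (s⁻¹) ^ 2 * W 1 := by
    intro s h
    have := hs s 1 h
    rwa [mul_one] at this
  have hWn : ∀ s, s ≠ 0 → W (- s ^ 2) = (s⁻¹) ^ 2 * (W 1 + 1) := by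
    intro s h
    have := hs s (-1) h
    have e := hd 1 one_ne_zero
    rw [show W 1 + 1 = W (-1) by rw [inv_one] at e; linear_combination e, ← this]
    simp
  have fin2 : 2 * W 1 = -1 → False := by
    intro h
    apply final
    intro x hx
    rcases hcl x hx with ⟨s, s0, rfl⟩ | ⟨s, s0, rfl⟩
    · rw [hWs s s0]; field_simp; linear_combination h
    · rw [hWn s s0]; field_simp; linear_combination -h
  have hα : W 1 ≠ 0 := by
    intro h
    have := hWW 1
    rw [h, h0] at this
    simp at this
  have hβ : W 1 + 1 ≠ 0 := by
    intro h
    have e := hWn 1 one_ne_zero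
    rw [h] at e
    have := hWW (-1)
    simp at e
    rw [e, h0] at this
    simp at this
  have h15 : Fintype.card F ≤ 15 := by
    classical
    apply alg_two (W 1) (- (W 1 + 1)) hα (neg_ne_zero.2 hβ) (by ring) W (fun x => if ∃ s, s ≠ 0 ∧ x = s ^ 2 then W 1 else - (W 1 + 1))
      _ _ (W (-1)) _ hc
    · intro x; split_ifs <;> simp
    · intro x hx
      by_cases h : ∃ s, s ≠ 0 ∧ x = s ^ 2
      · simp only [if_pos h]
        obtain ⟨s, s0, rfl⟩ := h
        rw [hWs s s0]; field_simp
      · simp only [if_neg h]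
        obtain ⟨s, s0, rfl⟩ := (hcl x hx).resolve_left h
        rw [hWn s s0]; field_simp
    · intro x h
      rw [← h, hWW]
  have h3 : Fintype.card F % 4 = 3 := by
    by_contra h
    exact hi (FiniteField.isSquare_neg_one_iff.2 h)
  have h4 : Fintype.card F = 15 := by omega
  obtain ⟨p, -, k, hp, hk⟩ := FiniteField.card' F
  rw [h4] at hk
  have d3 : 3 ∣ p := Nat.Prime.dvd_of_dvd_pow (by norm_num) (n := k) (by rw [← hk]; norm_num)
  have d5 : 5 ∣ p := Nat.Prime.dvd_of_dvd_pow (by norm_num) (n := k) (by rw [← hk]; norm_num)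
  have e3 := (Nat.prime_dvd_prime_iff_eq (by norm_num) hp).1 d3
  have e5 := (Nat.prime_dvd_prime_iff_eq (by norm_num) hp).1 d5
  omega
end two
end PSLMin

set_option linter.all false
namespace PSLMin
open Matrix

section mats
variable {F : Type*} [Field F]

def mu (x : F) : SL 2 F := ⟨!![1, x; 0, 1], by simp [det_fin_two]⟩
def ml (x : F) : SL 2 F := ⟨!![1, 0; x, 1], by simp [det_fin_two]⟩
def mt (a : Fˣ) : SL 2 F := ⟨!![(a : F), 0; 0, ((a⁻¹ : Fˣ) : F)], by simp [det_fin_two]⟩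
def mw : SL 2 F := ⟨!![0, 1; -1, 0], by simp [det_fin_two]⟩

lemma sl_ext2 {g h : SL 2 F} (H : (g : Matrix (Fin 2) (Fin 2) F) = h) : g = h := Subtype.ext H

lemma mu_zero : mu (0 : F) = 1 := by
  apply sl_ext2; change !![1, 0; 0, 1] = (1 : Matrix (Fin 2) (Fin 2) F); exact one_fin_two.symm
lemma mu_add (x y : F) : mu (x + y) = mu x * mu y := by
  apply sl_ext2
  change !![1, x + y; 0, 1] = !![1, x; 0, 1] * !![1, y; 0, 1]
  simp [add_comm]
lemma mt_mul (a b : Fˣ) : mt (a * b) = mt a * mt b := by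
  apply sl_ext2
  change !![((a * b : Fˣ) : F), 0; 0, (((a * b)⁻¹ : Fˣ) : F)] = !![(a : F), 0; 0, ((a⁻¹ : Fˣ) : F)] * !![(b : F), 0; 0, ((b⁻¹ : Fˣ) : F)]
  simp [mul_comm]
lemma mt_one : mt (1 : Fˣ) = 1 := by
  apply sl_ext2; change !![((1 : Fˣ) : F), 0; 0, ((1⁻¹ : Fˣ) : F)] = (1 : Matrix (Fin 2) (Fin 2) F); simp [one_fin_two]
lemma mt_neg_one : mt (-1 : Fˣ) = -1 := by
  apply sl_ext2; change !![((-1 : Fˣ) : F), 0; 0, (((-1)⁻¹ : Fˣ) : F)] = -(1 : Matrix (Fin 2) (Fin 2) F)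
  simp [one_fin_two]
lemma mt_mu (a : Fˣ) (x : F) : mt a * mu x = mu ((a : F) ^ 2 * x) * mt a := by
  apply sl_ext2
  change !![(a : F), 0; 0, ((a⁻¹ : Fˣ) : F)] * !![1, x; 0, 1] = !![1, (a : F) ^ 2 * x; 0, 1] * !![(a : F), 0; 0, ((a⁻¹ : Fˣ) : F)]
  simp
  field_simp
lemma mw_mw : (mw : SL 2 F) * mw = -1 := by
  apply sl_ext2
  change !![0, 1; -1, 0] * !![0, 1; -1, 0] = -(1 : Matrix (Fin 2) (Fin 2) F)
  simp [one_fin_two]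
lemma mw_mt (a : Fˣ) : mw * mt a = mt a⁻¹ * mw := by
  apply sl_ext2
  change !![0, 1; -1, 0] * !![(a : F), 0; 0, ((a⁻¹ : Fˣ) : F)] = !![((a⁻¹ : Fˣ) : F), 0; 0, ((a⁻¹⁻¹ : Fˣ) : F)] * !![0, 1; -1, 0]
  simp
lemma wuw (c : Fˣ) : mw * mu (c : F) * mw = (-1) * (mu (-(c : F)⁻¹) * mt c⁻¹ * mw * mu (-(c : F)⁻¹)) := by
  apply sl_ext2
  change !![0, 1; -1, 0] * !![1, (c : F); 0, 1] * !![0, 1; -1, 0] =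
    (-1 : Matrix (Fin 2) (Fin 2) F) * (!![1, -(c : F)⁻¹; 0, 1] * !![((c⁻¹ : Fˣ) : F), 0; 0, ((c⁻¹⁻¹ : Fˣ) : F)] * !![0, 1; -1, 0] * !![1, -(c : F)⁻¹; 0, 1])
  simp
lemma ml_eq (c : F) : ml c = mw⁻¹ * mu (-c) * mw := by
  rw [eq_comm, mul_assoc, inv_mul_eq_iff_eq_mul]
  apply sl_ext2
  change !![1, -c; 0, 1] * !![0, 1; -1, 0] = !![0, 1; -1, 0] * !![1, 0; c, 1]
  simp
lemma ml_zero : ml (0 : F) = 1 := by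
  apply sl_ext2; change !![1, 0; 0, 1] = (1 : Matrix (Fin 2) (Fin 2) F); exact one_fin_two.symm
lemma ml_add (x y : F) : ml (x + y) = ml x * ml y := by
  apply sl_ext2
  change !![1, 0; x + y, 1] = !![1, 0; x, 1] * !![1, 0; y, 1]
  simp [add_comm]

lemma gen2 (K : Subgroup (SL 2 F)) (h1 : ∀ x, mu x ∈ K) (h2 : ∀ x, ml x ∈ K) (g : SL 2 F) : g ∈ K := by
  have key : ∀ g : SL 2 F, g.1 1 0 ≠ 0 → g ∈ K := by
    intro g hg
    have hd := g.2
    rw [det_fin_two] at hd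
    have : g = mu ((g.1 0 0 - 1) / g.1 1 0) * ml (g.1 1 0) * mu ((g.1 1 1 - 1) / g.1 1 0) := by
      apply sl_ext2
      change g.1 = !![1, (g.1 0 0 - 1) / g.1 1 0; 0, 1] * !![1, 0; g.1 1 0, 1] * !![1, (g.1 1 1 - 1) / g.1 1 0; 0, 1]
      ext i j
      fin_cases i <;> fin_cases j <;> simp <;> field_simp <;> first | ring1 | linear_combination -hd
    rw [this]
    exact mul_mem (mul_mem (h1 _) (h2 _)) (h1 _)
  by_cases hg : g.1 1 0 = 0
  · have hd := g.2
    rw [det_fin_two, hg, mul_zero, sub_zero] at hd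
    have h3 : g * ml 1 ∈ K := by
      apply key
      change ((g.1 * !![1, 0; 1, 1] : Matrix (Fin 2) (Fin 2) F)) 1 0 ≠ 0
      simp [Matrix.mul_apply, hg]
      intro h0
      rw [h0, mul_zero] at hd
      exact zero_ne_one hd
    have := mul_mem h3 (inv_mem (h2 1))
    simpa using this
  · exact key g hg

/-- conjugation of w t_a with t_i -/
lemma wt_conj (h2 : (2 : F) ≠ 0) (i : Fˣ) (hi : (i : F) ^ 2 = -1) (a : Fˣ) : ∃ g : SL 2 F, mw * mt a * g = g * mt i := by
  refine ⟨⟨!![((a⁻¹ : Fˣ) : F), (i : F) / 2; (i : F), (a : F) / 2], ?_⟩, ?_⟩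
  · rw [det_fin_two]
    simp
    field_simp
    linear_combination -hi
  · apply sl_ext2
    change !![0, 1; -1, 0] * !![(a : F), 0; 0, ((a⁻¹ : Fˣ) : F)] * !![((a⁻¹ : Fˣ) : F), (i : F) / 2; (i : F), (a : F) / 2] =
      !![((a⁻¹ : Fˣ) : F), (i : F) / 2; (i : F), (a : F) / 2] * !![(i : F), 0; 0, ((i⁻¹ : Fˣ) : F)]
    have : ((i⁻¹ : Fˣ) : F) = - i := by
      rw [Units.val_inv_eq_inv_val]
      apply inv_eq_of_mul_eq_one_right
      linear_combination -hi
    rw [this]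
    ext k j
    fin_cases k <;> fin_cases j <;> simp <;> field_simp <;> first | ring1 | linear_combination hi | linear_combination -hi | linear_combination 2 * hi | linear_combination (-2 : F) * hi
end mats

section casea
variable {F : Type*} [Field F] [Fintype F] {Ω : Type*} {ρ : SL 2 F →* Equiv.Perm Ω}

lemma case_a (hq : 4 ≤ Fintype.card F) (hq5 : Fintype.card F ≠ 5) (hq7 : Fintype.card F ≠ 7) (hq11 : Fintype.card F ≠ 11)
    [Nonempty Ω] (hneg : ∀ ω, ρ (-1) ω = ω)
    (R1 : ∀ ω x, ρ (mu x) ω = ω → x = 0) (R2 : ∀ ω ω', ∃ x, ρ (mu x) ω = ω') : False := by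
  classical
  obtain ⟨ω⟩ := ‹Nonempty Ω›
  have R3 : ∀ ω x y, ρ (mu x) ω = ρ (mu y) ω → x = y := by
    intro ω x y h
    have e : mu x = mu y * mu (x - y) := by rw [← mu_add]; congr 1; ring
    rw [e, rho_mul] at h
    exact sub_eq_zero.1 (R1 _ _ ((ρ (mu y)).injective h))
  obtain ⟨a', ha'⟩ : ∃ a : F, a ∉ ({0, 1, -1} : Finset F) := by
    by_contra hc
    push Not at hc
    have := Finset.card_le_card (fun x _ => hc x : (Finset.univ : Finset F) ⊆ _)
    have h3 := Finset.card_le_three (a := (0 : F)) (b := 1) (c := -1)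
    rw [Finset.card_univ] at this
    omega
  simp only [Finset.mem_insert, Finset.mem_singleton, not_or] at ha'
  obtain ⟨ha0, ha1, ha2⟩ := ha'
  have hsq : a' ^ 2 ≠ 1 := by
    intro h
    rcases sq_eq_one_iff.1 h with h | h
    · exact ha1 h
    · exact ha2 h
  obtain ⟨a, rfl⟩ : ∃ a : Fˣ, (a : F) = a' := ⟨Units.mk0 a' ha0, rfl⟩
  have hsub : 1 - (a : F) ^ 2 ≠ 0 := sub_ne_zero.2 (Ne.symm hsq)
  obtain ⟨d, hd⟩ := R2 ω (ρ (mt a) ω)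
  obtain ⟨ω0, h0⟩ : ∃ ω0, ρ (mt a) ω0 = ω0 := by
    refine ⟨ρ (mu (d / (1 - (a : F) ^ 2))) ω, ?_⟩
    rw [← rho_mul, mt_mu, rho_mul, ← hd, ← rho_mul, ← mu_add]
    congr 3
    field_simp
    ring
  have huniq : ∀ ω, ρ (mt a) ω = ω → ω = ω0 := by
    intro ω h
    obtain ⟨x, rfl⟩ := R2 ω0 ω
    rw [← rho_mul, mt_mu, rho_mul, h0] at h
    have := R3 _ _ _ h
    have h1 : (1 - (a : F) ^ 2) * x = 0 := by linear_combination -this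
    have : x = 0 := (mul_eq_zero.1 h1).resolve_left hsub
    rw [this, mu_zero]; simp
  have hT : ∀ b : Fˣ, ρ (mt b) ω0 = ω0 := by
    intro b
    apply huniq
    rw [← rho_mul, ← mt_mul, mul_comm, mt_mul, rho_mul, h0]
  have hw : ρ mw ω0 = ω0 := by
    apply huniq
    have := mw_mt (a⁻¹)
    rw [inv_inv] at this
    rw [← rho_mul, ← this, rho_mul, hT]
  choose W hW using fun x => R2 ω0 (ρ (mw * mu x) ω0)
  apply alg hq hq5 hq7 hq11 W
  · apply R3 ω0
    rw [hW, mu_zero, mul_one, hw]; simp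
  · intro b x hb
    obtain ⟨b, rfl⟩ : ∃ a : Fˣ, (a : F) = b := ⟨Units.mk0 b hb, rfl⟩
    apply R3 ω0
    rw [hW]
    have e : mw * mu ((b : F) ^ 2 * x) * mt b = mt b⁻¹ * (mw * mu x) := by
      rw [mul_assoc, ← mt_mu, ← mul_assoc, mw_mt, mul_assoc]
    conv_lhs => rw [← hT b, ← rho_mul, e, rho_mul, ← hW, ← rho_mul, mt_mu, rho_mul, hT]
    simp
  · intro x
    apply R3 ω0
    rw [hW, rho_mul, hW, ← rho_mul, ← mul_assoc, mw_mw, rho_mul, hneg]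
  · intro x c hc
    obtain ⟨c, rfl⟩ : ∃ a : Fˣ, (a : F) = c := ⟨Units.mk0 c hc, rfl⟩
    apply R3 ω0
    rw [hW, add_comm, mu_add, ← mul_assoc, rho_mul, hW, ← rho_mul, ← mul_assoc, wuw, rho_mul, rho_mul, hneg, ← rho_mul, mul_assoc, ← mu_add, mul_assoc, rho_mul]
    rw [show -(c : F)⁻¹ + x = x - (c : F)⁻¹ by ring, ← hW, ← rho_mul, mul_assoc, mt_mu, ← mul_assoc, ← mu_add, rho_mul, hT]
    congr 3
    rw [Units.val_inv_eq_inv_val]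
    ring
end casea
end PSLMin

set_option linter.all false
namespace PSLMin
open Matrix

section caseb
variable {F : Type*} [Field F] [Fintype F] {Ω : Type*} (ρ : SL 2 F →* Equiv.Perm Ω)

def SS (ω : Ω) : AddSubgroup F where
  carrier := {x | ρ (mu x) ω = ω}
  zero_mem' := by simp [mu_zero]
  add_mem' := by
    intro a b h1 h2
    simp only [Set.mem_setOf_eq] at *
    rw [mu_add, rho_mul, h2, h1]
  neg_mem' := by
    intro a h
    simp only [Set.mem_setOf_eq] at *
    have : mu (-a) = (mu a)⁻¹ := by
      rw [eq_inv_iff_mul_eq_one, ← mu_add]; simp [mu_zero]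
    rw [this]; exact rho_inv ρ _ h

variable {ρ}
lemma mem_SS {ω : Ω} {x : F} : x ∈ SS ρ ω ↔ ρ (mu x) ω = ω := Iff.rfl

def UU (ψ : AddChar F ℂ) (ρ : SL 2 F →* Equiv.Perm Ω) (ω : Ω) (c : F) : Prop := ∀ x ∈ SS ρ ω, ψ (x * c) = 1

def ee : Fin 2 → F := ![1, 0]
lemma ee_ne : (ee : Fin 2 → F) ≠ 0 := by
  intro h
  have := congrFun h 0
  simp [ee] at this

lemma dot_ee (φ : Fin 2 → F) : φ ⬝ᵥ ee = φ 0 := by simp [ee, dotProduct, Fin.sum_univ_two]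

lemma tv_ee (φ : Fin 2 → F) (h : φ 0 = 0) : tv ee φ = mu (φ 1) := by
  apply sl_ext2
  rw [tv_coe (by rw [dot_ee, h])]
  change _ = !![1, φ 1; 0, 1]
  ext i j
  rw [Matrix.add_apply, vecMulVec_apply]
  fin_cases i <;> fin_cases j <;> simp [ee, h]

lemma mem_Sg_ee {ω : Ω} {φ : Fin 2 → F} : φ ∈ Sg ρ ee ω ↔ φ 0 = 0 ∧ φ 1 ∈ SS ρ ω := by
  rw [mem_Sg, dot_ee, mem_SS]
  constructor
  · rintro ⟨h1, h2⟩
    rw [tv_ee _ h1] at h2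
    exact ⟨h1, h2⟩
  · rintro ⟨h1, h2⟩
    rw [tv_ee _ h1]
    exact ⟨h1, h2⟩

lemma card_Sg_ee (ω : Ω) : Nat.card (Sg ρ ee ω) = Nat.card (SS ρ ω) := by
  apply Nat.card_congr
  exact { toFun := fun φ => ⟨φ.1 1, (mem_Sg_ee.1 φ.2).2⟩
          invFun := fun x => ⟨![0, x.1], mem_Sg_ee.2 ⟨by simp, by simpa using x.2⟩⟩
          left_inv := by
            intro φ
            have := (mem_Sg_ee.1 φ.2).1
            apply Subtype.ext
            ext i
            fin_cases i
            · simp [this]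
            · simp
          right_inv := by intro x; simp }

lemma Pp_ee {ψ : AddChar F ℂ} {ω : Ω} {y : Fin 2 → F} : Pp ψ (Sg ρ ee ω) y ↔ UU ψ ρ ω (y 1) := by
  constructor
  · intro h x hx
    have := h ![0, x] (mem_Sg_ee.2 ⟨by simp, by simpa using hx⟩)
    simpa [dotProduct, Fin.sum_univ_two] using this
  · intro h φ hφ
    obtain ⟨h1, h2⟩ := mem_Sg_ee.1 hφ
    have := h _ h2
    simpa [dotProduct, Fin.sum_univ_two, h1] using this

lemma UU_zero {ψ : AddChar F ℂ} (ω : Ω) : UU ψ ρ ω 0 := by intro x _; simp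

lemma UU_sep {ψ : AddChar F ℂ} (hψ : ψ ≠ 1) {ω : Ω} {x : F} (hx : x ∉ SS ρ ω) : ∃ c, UU ψ ρ ω c ∧ ψ (x * c) ≠ 1 := by
  obtain ⟨y, h1, h2⟩ := exists_sep hψ (S := Sg ρ ee ω) (θ := ![0, x]) (by rw [mem_Sg_ee]; simpa using hx)
  exact ⟨y 1, Pp_ee.1 h1, by simpa [dotProduct, Fin.sum_univ_two] using h2⟩

lemma sum_fin2 {M : Type*} [AddCommMonoid M] (f : F → M) : ∑ y : Fin 2 → F, f (y 1) = Fintype.card F • ∑ c, f c := by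
  rw [← (finTwoArrowEquiv F).symm.sum_comp, Fintype.sum_prod_type]
  simp [finTwoArrowEquiv]

open Classical in
lemma card_UU {ψ : AddChar F ℂ} (hψ : ψ ≠ 1) (ω : Ω) :
    Nat.card (SS ρ ω) * (Finset.univ.filter (fun c => UU ψ ρ ω c)).card = Fintype.card F := by
  have h := card_Pp hψ (Sg ρ ee ω)
  rw [card_Sg_ee] at h
  simp_rw [Pp_ee] at h
  rw [Finset.card_filter, sum_fin2 (fun c => if UU ψ ρ ω c then 1 else 0), ← Finset.card_filter, smul_eq_mul, sq] at h
  have hq : 0 < Fintype.card F := Fintype.card_pos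
  apply Nat.eq_of_mul_eq_mul_left hq
  rw [← h]; ring

lemma UU_orbit {ψ : AddChar F ℂ} (ω : Ω) (x : F) : SS ρ (ρ (mu x) ω) = SS ρ ω := by
  ext y
  rw [mem_SS, mem_SS, ← rho_mul, ← mu_add, add_comm, mu_add, rho_mul, EmbeddingLike.apply_eq_iff_eq]

lemma SS_mt (a : Fˣ) (ω : Ω) (x : F) : (a : F) ^ 2 * x ∈ SS ρ (ρ (mt a) ω) ↔ x ∈ SS ρ ω := by
  rw [mem_SS, mem_SS, ← rho_mul, ← mt_mu, rho_mul, EmbeddingLike.apply_eq_iff_eq]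

lemma UU_mt {ψ : AddChar F ℂ} (a : Fˣ) (ω : Ω) (c : F) : UU ψ ρ (ρ (mt a) ω) c ↔ UU ψ ρ ω ((a : F) ^ 2 * c) := by
  constructor
  · intro h x hx
    have := h _ ((SS_mt a ω x).2 hx)
    rw [← this]; congr 1; ring
  · intro h x hx
    have := h ((a : F)⁻¹ ^ 2 * x) (by rw [← SS_mt a]; simpa using hx)
    rw [← this]
    congr 1
    field_simp

lemma card_SS_mt (a : Fˣ) (ω : Ω) : Nat.card (SS ρ (ρ (mt a) ω)) = Nat.card (SS ρ ω) := by
  symm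
  apply Nat.card_congr
  exact { toFun := fun x => ⟨(a : F) ^ 2 * x.1, (SS_mt a ω _).2 x.2⟩
          invFun := fun x => ⟨(a : F)⁻¹ ^ 2 * x.1, by rw [← SS_mt a]; simpa using x.2⟩
          left_inv := by intro x; simp
          right_inv := by intro x; simp }

variable [Fintype Ω]
noncomputable def Bc (ψ : AddChar F ℂ) (ρ : SL 2 F →* Equiv.Perm Ω) (c : F) : ℕ := Bw ψ ρ ee ![0, c]

open Classical in
lemma Bc_eq (ψ : AddChar F ℂ) (c : F) : Bc ψ ρ c = ∑ ω : Ω, if UU ψ ρ ω c then Nat.card (SS ρ ω) else 0 := by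
  unfold Bc Bw
  apply Finset.sum_congr rfl
  intro ω _
  rw [card_Sg_ee]
  congr 1
  rw [Pp_ee]
  simp

lemma Bc_sum {ψ : AddChar F ℂ} (hψ : ψ ≠ 1) : ∑ c, Bc ψ ρ c = Fintype.card F * Fintype.card Ω := by
  classical
  have h := Bw_sum (ρ := ρ) hψ ee
  have : ∀ y : Fin 2 → F, Bw ψ ρ ee y = Bc ψ ρ (y 1) := by
    intro y
    unfold Bc Bw
    simp_rw [Pp_ee]
    simp
  simp_rw [this] at h
  rw [sum_fin2, smul_eq_mul, sq, mul_assoc] at h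
  exact Nat.eq_of_mul_eq_mul_left Fintype.card_pos h

lemma Bc_le {ψ : AddChar F ℂ} {ω : Ω} {c : F} (h : UU ψ ρ ω c) : Fintype.card F ≤ Bc ψ ρ c := by
  have := Bw_le_of_mem (ρ := ρ) (le_refl 2) ψ ee_ne (x := ![0, c]) (ω := ω) (by rw [Pp_ee]; simpa using h)
  simpa [Bc] using this

lemma Bc_two {ψ : AddChar F ℂ} {ω ω' : Ω} {c : F} (h : UU ψ ρ ω c) (h' : UU ψ ρ ω' c) (hB : Bc ψ ρ c < 2 * Fintype.card F) :
    ∃ x, ρ (mu x) ω = ω' := by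
  obtain ⟨φ, h1, h2⟩ := Bw_two (ρ := ρ) (le_refl 2) ψ ee_ne (x := ![0, c]) (ω := ω) (ω' := ω') (by rw [Pp_ee]; simpa using h) (by rw [Pp_ee]; simpa using h') (by simpa [Bc] using hB)
  rw [dot_ee] at h1
  rw [tv_ee _ h1] at h2
  exact ⟨_, h2⟩

lemma Bc_ex {ψ : AddChar F ℂ} {c : F} (h : Bc ψ ρ c ≠ 0) : ∃ ω, UU ψ ρ ω c := by
  classical
  by_contra hc
  push Not at hc
  apply h
  rw [Bc_eq]
  exact Finset.sum_eq_zero (fun ω _ => if_neg (hc ω))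

lemma Bc_sq {ψ : AddChar F ℂ} (c : F) (a : Fˣ) : Bc ψ ρ ((a : F) ^ 2 * c) = Bc ψ ρ c := by
  classical
  rw [Bc_eq, Bc_eq, ← Equiv.sum_comp (ρ (mt a)) (fun ω => if UU ψ ρ ω c then Nat.card (SS ρ ω) else 0)]
  simp_rw [UU_mt, card_SS_mt]

/-- if B(c) < 2 q and B(c) ≠ 0 then B(c) = q -/
lemma Bc_q {ψ : AddChar F ℂ} {ω : Ω} {c : F} (h : UU ψ ρ ω c) (hB : Bc ψ ρ c < 2 * Fintype.card F) : Bc ψ ρ c = Fintype.card F := by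
  classical
  have h1 := orb_sum (ρ := ρ) (le_refl 2) ee_ne ω
  rw [show Fintype.card F = Fintype.card F ^ (2 - 1) by simp, ← h1, Bc_eq, ← Finset.sum_filter]
  simp_rw [card_Sg_ee]
  apply Finset.sum_congr _ (fun _ _ => rfl)
  ext ω'
  rw [Finset.mem_filter_univ, mem_orb]
  constructor
  · intro h'
    obtain ⟨x, hx⟩ := Bc_two h h' hB
    exact ⟨![0, x], by rw [dot_ee]; simp, by rw [tv_ee _ (by simp)]; simpa using hx⟩
  · rintro ⟨φ, h1, h2⟩
    rw [dot_ee] at h1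
    rw [tv_ee _ h1] at h2
    intro x hx
    rw [← h2, UU_orbit (ψ := ψ)] at hx
    exact h x hx

lemma no_fix2 (htr : ∀ ω ω' : Ω, ∃ g, ρ g ω = ω') (hN2 : 2 ≤ Fintype.card Ω) (hneg : ∀ ω : Ω, ρ (-1) ω = ω)
    (hN : Fintype.card Ω ≤ Fintype.card F) (ω : Ω) (h : ∀ x, ρ (mu x) ω = ω) : False := by
  have hml : (∀ x, ρ (ml x) ω = ω) → False := by
    intro h'
    let K : Subgroup (SL 2 F) :=
      { carrier := {g | ρ g ω = ω}
        one_mem' := by simp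
        mul_mem' := by intro a b ha hb; simp only [Set.mem_setOf_eq] at *; rw [rho_mul, hb, ha]
        inv_mem' := by intro a ha; exact rho_inv ρ _ ha }
    obtain ⟨ω', hω'⟩ := Fintype.exists_ne_of_one_lt_card (by omega : 1 < Fintype.card Ω) ω
    obtain ⟨g, hg⟩ := htr ω ω'
    have : g ∈ K := gen2 K h h' g
    exact hω' (hg.symm.trans this)
  have hw : ρ mw ω ≠ ω := by
    intro hw
    apply hml
    intro x
    rw [ml_eq, rho_mul, rho_mul, hw, h, rho_inv ρ _ hw]
  let f : Option F → Ω := fun o => o.elim ω (fun x => ρ (mu x * mw) ω)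
  have hinj : Function.Injective f := by
    have hne : ∀ x, ρ (mu x * mw) ω ≠ ω := by
      intro x hx
      apply hw
      rw [rho_mul] at hx
      have := rho_inv ρ _ hx
      rw [rho_inv ρ _ (h x)] at this
      exact this.symm
    rintro (_ | x) (_ | y) hxy
    · rfl
    · exact absurd hxy.symm (hne y)
    · exact absurd hxy (hne x)
    · congr 1
      by_contra hne'
      obtain ⟨c, hc⟩ : ∃ c : Fˣ, (c : F) = x - y := ⟨Units.mk0 (x - y) (sub_ne_zero.2 hne'), rfl⟩
      have e1 : ρ (mu (c : F) * mw) ω = ρ mw ω := by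
        change ρ (mu x * mw) ω = ρ (mu y * mw) ω at hxy
        have : mu x = mu y * mu (c : F) := by rw [← mu_add, hc]; congr 1; ring
        rw [this, mul_assoc, rho_mul, rho_mul _ (mu y)] at hxy
        exact (ρ (mu y)).injective hxy
      have e2 : ρ (mw * mu (c : F) * mw) ω = ω := by
        rw [mul_assoc, rho_mul, e1, ← rho_mul, mw_mw, hneg]
      rw [wuw, rho_mul, hneg, rho_mul, h, mul_assoc, rho_mul] at e2
      have e3 := rho_inv ρ _ e2
      rw [rho_inv ρ _ (h _)] at e3
      -- now t w fixes ω
      have e4 : ρ mw ω = ρ (mt c) ω := by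
        have : mw = mt c * (mt c⁻¹ * mw) := by rw [← mul_assoc, ← mt_mul]; simp [mt_one]
        rw [this, rho_mul, ← e3]
      apply hml
      intro x
      rw [ml_eq, rho_mul, rho_mul, e4, ← rho_mul (ρ) (mu _)]
      have e5 : mu (-x) * mt c = mt c * mu ((((c⁻¹ : Fˣ) : F)) ^ 2 * -x) := by
        rw [mt_mu]; simp
      rw [e5, rho_mul, h, rho_inv ρ _ e4]
  have := Fintype.card_le_of_injective f hinj
  rw [Fintype.card_option] at this
  omega
end caseb
end PSLMin

set_option linter.all false
namespace PSLMin
open Matrix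

section caseb2
variable {F : Type*} [Field F] [Fintype F] {Ω : Type*} [Fintype Ω] {ρ : SL 2 F →* Equiv.Perm Ω}

lemma reg_of {ψ : AddChar F ℂ} (hN : Fintype.card Ω = Fintype.card F) (hB0 : Bc ψ ρ 0 ≤ Fintype.card F) :
    (∀ ω x, ρ (mu x) ω = ω → x = 0) ∧ (∀ ω ω', ∃ x, ρ (mu x) ω = ω') := by
  classical
  have h1 : ∀ ω, Nat.card (SS ρ ω) = 1 := by
    rw [Bc_eq, ← hN, ← Finset.card_univ, Finset.card_eq_sum_ones] at hB0
    simp_rw [if_pos (UU_zero _)] at hB0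
    have hle : ∀ ω ∈ (Finset.univ : Finset Ω), 1 ≤ Nat.card (SS ρ ω) := fun ω _ => Nat.card_pos
    have := (Finset.sum_eq_sum_iff_of_le hle).1 (le_antisymm (Finset.sum_le_sum hle) hB0)
    intro ω
    exact (this ω (Finset.mem_univ _)).symm
  have R1 : ∀ ω x, ρ (mu x) ω = ω → x = 0 := by
    intro ω x hx
    have := (AddSubgroup.card_eq_one.1 (h1 ω))
    have hx : x ∈ SS ρ ω := hx
    rw [this] at hx
    simpa using hx
  refine ⟨R1, ?_⟩
  intro ω
  have hinj : Function.Injective (fun x : F => ρ (mu x) ω) := by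
    intro x y h
    have e : mu x = mu y * mu (x - y) := by rw [← mu_add]; congr 1; ring
    simp only [] at h
    rw [e, rho_mul] at h
    exact sub_eq_zero.1 (R1 _ _ ((ρ (mu y)).injective h))
  exact ((Fintype.bijective_iff_injective_and_card _).2 ⟨hinj, hN.symm⟩).2

lemma ringChar_ne {F : Type*} [Field F] (h2 : (2 : F) ≠ 0) : ringChar F ≠ 2 := by
  intro hh
  apply h2
  have := ringChar.Nat.cast_ringChar (R := F)
  rw [hh] at this
  exact_mod_cast this

/-- Either the unipotent group is regular, or we are in the special case. -/
lemma dich {ψ : AddChar F ℂ} (hψ : ψ ≠ 1) (htr : ∀ ω ω' : Ω, ∃ g, ρ g ω = ω') (hN2 : 2 ≤ Fintype.card Ω) (hneg : ∀ ω : Ω, ρ (-1) ω = ω)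
    (hN : Fintype.card Ω ≤ Fintype.card F) :
    ((∀ ω x, ρ (mu x) ω = ω → x = 0) ∧ (∀ ω ω', ∃ x, ρ (mu x) ω = ω')) ∨
    ((2 : F) ≠ 0 ∧ ∃ c1 c0 : F, c1 ≠ 0 ∧ c0 ≠ 0 ∧ Bc ψ ρ c0 = 0 ∧ Bc ψ ρ c1 = Fintype.card F ∧
      (∀ c, c ≠ 0 → (∃ s : Fˣ, c = s ^ 2 * c1) ∨ (∃ s : Fˣ, c = s ^ 2 * c0)) ∧
      2 * Bc ψ ρ 0 + (Fintype.card F - 1) * Fintype.card F = 2 * (Fintype.card F * Fintype.card Ω)) := by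
  classical
  have hne : Nonempty Ω := Fintype.card_pos_iff.1 (by omega)
  obtain ⟨ω0⟩ := hne
  have hq : 1 < Fintype.card F := Fintype.one_lt_card
  have hsum := Bc_sum (ρ := ρ) hψ
  have hB0 : Fintype.card F ≤ Bc ψ ρ 0 := Bc_le (UU_zero ω0)
  have hge : ∀ c, Bc ψ ρ c ≠ 0 → Fintype.card F ≤ Bc ψ ρ c := by
    intro c h
    obtain ⟨ω, h⟩ := Bc_ex h
    exact Bc_le h
  have hfin : ∀ k, Fintype.card F ≤ k → 2 * Bc ψ ρ 0 + (Fintype.card F - 1) * (2 * k) ≤ 2 * (Fintype.card F * Fintype.card Ω) →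
      ((∀ ω x, ρ (mu x) ω = ω → x = 0) ∧ (∀ ω ω', ∃ x, ρ (mu x) ω = ω')) := by
    intro k hk h
    obtain ⟨m, hm⟩ : ∃ m, Fintype.card F = m + 1 := ⟨Fintype.card F - 1, by omega⟩
    have h1 : Fintype.card F * Fintype.card Ω ≤ Fintype.card F * Fintype.card F := Nat.mul_le_mul_left _ hN
    have h2 : m * Fintype.card F ≤ m * k := Nat.mul_le_mul_left _ hk
    rw [hm, Nat.add_sub_cancel] at h
    rw [hm] at h1 h2 hB0 hN
    have h3 : Bc ψ ρ 0 + m * (m + 1) ≤ (m + 1) * Fintype.card Ω := by nlinarith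
    have h4 : m + 1 ≤ Fintype.card Ω := by
      by_contra hc
      have : Fintype.card Ω ≤ m := by omega
      have := Nat.mul_le_mul_left (m + 1) this
      nlinarith
    apply reg_of (ψ := ψ) (by omega)
    rw [hm]
    nlinarith
  have hpos : ∃ c, c ≠ 0 ∧ Bc ψ ρ c ≠ 0 := by
    obtain ⟨x, hx⟩ : ∃ x, x ∉ SS ρ ω0 := by
      by_contra hc
      push Not at hc
      exact no_fix2 htr hN2 hneg hN ω0 hc
    obtain ⟨c, h1, h2⟩ := UU_sep hψ hx
    refine ⟨c, ?_, ?_⟩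
    · rintro rfl; simp at h2
    · have := Bc_le h1; omega
  obtain ⟨c, hc0, hc⟩ := hpos
  by_cases hall : ∀ c, c ≠ 0 → Bc ψ ρ c ≠ 0
  · left
    apply hfin _ le_rfl
    have h1 : Bc ψ ρ 0 + (Fintype.card F - 1) * Fintype.card F ≤ ∑ c, Bc ψ ρ c := by
      rw [← Finset.add_sum_erase _ _ (Finset.mem_univ (0 : F))]
      have : (Finset.univ.erase (0 : F)).card = Fintype.card F - 1 := by
        rw [Finset.card_erase_of_mem (Finset.mem_univ _), Finset.card_univ]
      rw [← this, ← smul_eq_mul]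
      gcongr
      apply Finset.card_nsmul_le_sum
      intro x hx
      exact hge x (hall x (Finset.ne_of_mem_erase hx))
    rw [hsum] at h1
    calc _ = 2 * (Bc ψ ρ 0 + (Fintype.card F - 1) * Fintype.card F) := by ring
      _ ≤ _ := Nat.mul_le_mul_left _ h1
  push Not at hall
  obtain ⟨c0, hc00, hB⟩ := hall
  have hsq : ∀ x y : F, x ≠ 0 → y ≠ 0 → IsSquare (x * y) → ∃ s : Fˣ, x = s ^ 2 * y := by
    intro x y hx hy h
    obtain ⟨s, hs⟩ := h
    have hs0 : s ≠ 0 := by rintro rfl; simp [hx, hy] at hs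
    refine ⟨Units.mk0 (s / y) (div_ne_zero hs0 hy), ?_⟩
    simp
    field_simp
    linear_combination hs
  have hnsq : ¬ IsSquare (c * c0) := by
    intro h
    obtain ⟨s, hs⟩ := hsq _ _ hc0 hc00 h
    rw [hs, Bc_sq] at hc
    exact hc hB
  have h2 : (2 : F) ≠ 0 := by
    intro h2
    apply hnsq
    apply FiniteField.isSquare_of_char_two
    haveI : CharP F 2 := CharTwo.of_one_ne_zero_of_two_eq_zero one_ne_zero h2
    exact ringChar.eq F 2 ▸ rfl
  have hcl : ∀ x, x ≠ 0 → IsSquare (x * c) ∨ IsSquare (x * c0) := by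
    intro x hx
    by_contra hcon
    push Not at hcon
    have h1 := nsq_mul hcon.1 hnsq
    apply hcon.2
    rw [show x * c * (c * c0) = (x * c0) * (c * c) by ring] at h1
    obtain ⟨s, hs⟩ := h1
    refine ⟨s / c, ?_⟩
    field_simp
    linear_combination hs
  have hs2 : (2 : ℤ) * (Bc ψ ρ 0 : ℤ) + (Fintype.card F - 1) * (Bc ψ ρ c) = 2 * (Fintype.card F * Fintype.card Ω) := by
    have hz : ∀ x : F, 2 * (Bc ψ ρ x : ℤ) = (if x = 0 then 2 * (Bc ψ ρ 0 : ℤ) - Bc ψ ρ c else 0) + Bc ψ ρ c + quadraticChar F x * (quadraticChar F c * Bc ψ ρ c) := by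
      intro x
      by_cases hx : x = 0
      · simp [hx]
      rw [if_neg hx]
      by_cases h : IsSquare (x * c)
      · obtain ⟨s, hs⟩ := hsq _ _ hx hc0 h
        rw [← quadraticChar_one_iff_isSquare (mul_ne_zero hx hc0), map_mul] at h
        rw [← mul_assoc, h, hs, Bc_sq]; ring
      · have h' := (hcl x hx).resolve_left h
        obtain ⟨s, hs⟩ := hsq _ _ hx hc00 h'
        rw [← quadraticChar_neg_one_iff_not_isSquare, map_mul] at h
        rw [← mul_assoc, h, hs, Bc_sq, hB]; simp
    have hsz : ∑ x, 2 * (Bc ψ ρ x : ℤ) = 2 * (Fintype.card F * Fintype.card Ω) := by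
      rw [← Finset.mul_sum]
      congr 1
      exact_mod_cast hsum
    rw [← hsz]
    rw [Finset.sum_congr rfl (fun x _ => hz x)]
    rw [Finset.sum_add_distrib, Finset.sum_add_distrib, ← Finset.sum_mul, quadraticChar_sum_zero (ringChar_ne h2)]
    simp
    ring
  have hs3 : 2 * Bc ψ ρ 0 + (Fintype.card F - 1) * (Bc ψ ρ c) = 2 * (Fintype.card F * Fintype.card Ω) := by
    zify [hq.le]
    exact hs2
  by_cases hbig : 2 * Fintype.card F ≤ Bc ψ ρ c
  · left
    apply hfin _ le_rfl
    rw [← hs3]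
    gcongr
  · right
    obtain ⟨ω, hω⟩ := Bc_ex hc
    have hBq := Bc_q hω (by omega)
    refine ⟨h2, c, c0, hc0, hc00, hB, hBq, ?_, by rw [hBq] at hs3; exact hs3⟩
    intro x hx
    rcases hcl x hx with h | h
    · exact Or.inl (hsq _ _ hx hc0 h)
    · exact Or.inr (hsq _ _ hx hc00 h)
end caseb2
end PSLMin

set_option linter.all false
namespace PSLMin
open Matrix

section caseb3
variable {F : Type*} [Field F] [Fintype F] {Ω : Type*} [Fintype Ω] {ρ : SL 2 F →* Equiv.Perm Ω}

open Classical in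
noncomputable def fx (ρ : SL 2 F →* Equiv.Perm Ω) (g : SL 2 F) : ℕ := (Finset.univ.filter (fun ω => ρ g ω = ω)).card

open Classical in
lemma fx_sum (g : SL 2 F) : ∑ ω : Ω, (Finset.univ.filter (fun x : F => ρ g (ρ (mu x) ω) = ρ (mu x) ω)).card = Fintype.card F * fx ρ g := by
  simp_rw [Finset.card_filter]
  rw [Finset.sum_comm]
  have : ∀ x : F, ∑ ω : Ω, (if ρ g (ρ (mu x) ω) = ρ (mu x) ω then 1 else 0) = fx ρ g := by
    intro x
    rw [fx, Finset.card_filter]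
    exact Equiv.sum_comp (ρ (mu x)) (fun ω => if ρ g ω = ω then 1 else 0)
  simp_rw [this]
  simp

open Classical in
lemma card_SS_filter (ω : Ω) : Nat.card (SS ρ ω) = (Finset.univ.filter (fun x => x ∈ SS ρ ω)).card := by
  rw [Nat.card_eq_fintype_card, Fintype.card_subtype]

lemma fix_mt {a : Fˣ} (ha : (a : F) ^ 2 ≠ 1) {ω : Ω} (h : ρ (mt a) ω = ω) {d : F} (hd : ρ (mt a) (ρ (mu d) ω) = ρ (mu d) ω) : d ∈ SS ρ ω := by
  rw [← rho_mul, mt_mu, rho_mul, h] at hd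
  have h1 : ((a : F) ^ 2 - 1) * d ∈ SS ρ ω := by
    rw [mem_SS, show ((a : F) ^ 2 - 1) * d = -d + (a : F) ^ 2 * d by ring, mu_add, rho_mul, hd, ← rho_mul, ← mu_add]
    simp [mu_zero]
  have hinv : ∀ x ∈ SS ρ ω, (a : F) ^ 2 * x ∈ SS ρ ω := by
    intro x hx
    have := (SS_mt a ω x).2 hx
    rwa [h] at this
  let f : SS ρ ω → SS ρ ω := fun x => ⟨((a : F) ^ 2 - 1) * x.1, by
    rw [sub_mul, one_mul]; exact sub_mem (hinv _ x.2) x.2⟩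
  have hf : Function.Injective f := by
    intro x y hxy
    have := congrArg Subtype.val hxy
    apply Subtype.ext
    exact mul_left_cancel₀ (sub_ne_zero.2 ha) this
  obtain ⟨y, hy⟩ := (Finite.injective_iff_surjective.1 hf) ⟨_, h1⟩
  have := mul_left_cancel₀ (sub_ne_zero.2 ha) (congrArg Subtype.val hy)
  rw [← this]; exact y.2

lemma fx_le {s0 : ℕ} (hs : ∀ ω : Ω, Nat.card (SS ρ ω) = s0) {a : Fˣ} (ha : (a : F) ^ 2 ≠ 1) : Fintype.card F * fx ρ (mt a) ≤ Fintype.card Ω * s0 := by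
  classical
  rw [← fx_sum, ← smul_eq_mul, ← Finset.card_univ]
  apply Finset.sum_le_card_nsmul
  intro ω _
  by_cases hx : ∃ x0, ρ (mt a) (ρ (mu x0) ω) = ρ (mu x0) ω
  · obtain ⟨x0, hx0⟩ := hx
    rw [← hs ω, card_SS_filter]
    apply Finset.card_le_card_of_injOn (fun x => x - x0)
    · intro x hx
      simp only [Finset.coe_filter, Finset.mem_univ, true_and, Set.mem_setOf_eq] at hx ⊢
      have e : mu x = mu (x - x0) * mu x0 := by rw [← mu_add]; congr 1; ring
      rw [e, rho_mul ρ (mu (x - x0))] at hx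
      have := fix_mt ha hx0 hx
      rwa [UU_orbit (ψ := 1)] at this
    · intro x _ y _ h
      simpa using h
  · push Not at hx
    rw [Finset.filter_false_of_mem (fun x _ => hx x)]
    simp

lemma case_b {ψ : AddChar F ℂ} (hψ : ψ ≠ 1) (htr : ∀ ω ω' : Ω, ∃ g, ρ g ω = ω') (hN2 : 2 ≤ Fintype.card Ω) (hneg : ∀ ω : Ω, ρ (-1) ω = ω)
    (hN : Fintype.card Ω ≤ Fintype.card F) (hq9 : Fintype.card F ≠ 9) (h2 : (2 : F) ≠ 0) {c1 c0 : F} (hc1 : c1 ≠ 0) (hc0 : c0 ≠ 0)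
    (hB0 : Bc ψ ρ c0 = 0) (hB1 : Bc ψ ρ c1 = Fintype.card F)
    (hcl : ∀ c, c ≠ 0 → (∃ s : Fˣ, c = s ^ 2 * c1) ∨ (∃ s : Fˣ, c = s ^ 2 * c0))
    (hcount : 2 * Bc ψ ρ 0 + (Fintype.card F - 1) * Fintype.card F = 2 * (Fintype.card F * Fintype.card Ω)) : False := by
  classical
  have hq : 1 < Fintype.card F := Fintype.one_lt_card
  have hU0 : ∀ ω, ¬ UU ψ ρ ω c0 := by
    intro ω h
    have := Bc_le h
    omega
  have hcls : ∀ ω c, c ≠ 0 → UU ψ ρ ω c → ∃ s : Fˣ, c = s ^ 2 * c1 := by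
    intro ω c hc h
    rcases hcl c hc with h' | ⟨s, rfl⟩
    · exact h'
    · rw [← UU_mt] at h
      exact absurd h (hU0 _)
  obtain ⟨ω1, hω1⟩ := Bc_ex (ρ := ρ) (ψ := ψ) (c := c1) (by omega)
  have hone : ∀ ω, UU ψ ρ ω c1 → ∃ x, ρ (mu x) ω = ω1 := fun ω h => Bc_two h hω1 (by omega)
  have hmove : ∀ ω, ∃ s : Fˣ, UU ψ ρ (ρ (mt s) ω) c1 := by
    intro ω
    obtain ⟨x, hx⟩ : ∃ x, x ∉ SS ρ ω := by
      by_contra hc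
      push Not at hc
      exact no_fix2 htr hN2 hneg hN ω hc
    obtain ⟨c, h3, h4⟩ := UU_sep hψ hx
    obtain ⟨s, rfl⟩ := hcls ω c (by rintro rfl; simp at h4) h3
    exact ⟨s, (UU_mt s ω c1).2 h3⟩
  obtain ⟨s0, hs0⟩ : ∃ s0, s0 = Nat.card (SS ρ ω1) := ⟨_, rfl⟩
  have hs : ∀ ω, Nat.card (SS ρ ω) = s0 := by
    intro ω
    obtain ⟨s, h⟩ := hmove ω
    obtain ⟨x, hx⟩ := hone _ h
    rw [hs0, ← hx, UU_orbit (ψ := ψ), card_SS_mt]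
  obtain ⟨q0, hq0⟩ : ∃ q0, q0 = (Finset.univ.filter (fun c => UU ψ ρ ω1 c)).card := ⟨_, rfl⟩
  have hsq : s0 * q0 = Fintype.card F := by rw [hq0, hs0]; exact card_UU hψ ω1
  have hB0' : Bc ψ ρ 0 = Fintype.card Ω * s0 := by
    rw [Bc_eq]
    simp_rw [if_pos (UU_zero _), hs]
    simp
  -- square root of -1
  have hUneg : ∀ ω c, UU ψ ρ ω c → UU ψ ρ ω (-c) := by
    intro ω c h x hx
    have := h (-x) (neg_mem hx)
    rw [← this]; congr 1; ring
  obtain ⟨i, hi⟩ := hcls ω1 (-c1) (neg_ne_zero.2 hc1) (hUneg _ _ hω1)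
  have hi2 : (i : F) ^ 2 = -1 := by
    apply mul_right_cancel₀ hc1
    rw [← hi]; ring
  have h11 : (-1 : F) ≠ 1 := by
    intro h
    apply h2
    linear_combination -h
  -- z = t_i
  obtain ⟨M, hM⟩ : ∃ M, M = fx ρ (mt i) := ⟨_, rfl⟩
  have hle1 := fx_le (ρ := ρ) hs (a := i) (by rw [hi2]; exact h11)
  have hge1 : Fintype.card Ω * s0 ≤ Fintype.card F * fx ρ (mt i) := by
    rw [← fx_sum, ← smul_eq_mul, ← Finset.card_univ]
    apply Finset.card_nsmul_le_sum
    intro ω _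
    -- z preserves the orbit
    obtain ⟨d, hd⟩ : ∃ d, ρ (mu d) ω = ρ (mt i) ω := by
      obtain ⟨s, h⟩ := hmove ω
      have h' : UU ψ ρ (ρ (mt i) (ρ (mt s) ω)) c1 := by
        rw [UU_mt, hi2, neg_one_mul]
        exact hUneg _ _ h
      obtain ⟨x, hx⟩ := Bc_two h h' (by omega)
      rw [← rho_mul ρ (mt i), ← mt_mul, mul_comm, mt_mul, rho_mul ρ (mt s)] at hx
      refine ⟨((s⁻¹ : Fˣ) : F) ^ 2 * x, ?_⟩
      apply (ρ (mt s)).injective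
      rw [← hx, ← rho_mul, ← rho_mul, mt_mu]
      congr 3
      simp
    rw [← hs ω, card_SS_filter]
    apply Finset.card_le_card_of_injOn (fun x => x + d / 2)
    · intro x hx
      simp only [Finset.coe_filter, Finset.mem_univ, true_and, Set.mem_setOf_eq] at hx ⊢
      rw [← rho_mul, mt_mu, rho_mul, ← hd, ← rho_mul, ← mu_add, hi2]
      have e1 : -1 * (x + d / 2) + d = d / 2 + (-x) := by field_simp; ring
      have e2 : x + d / 2 = d / 2 + x := by ring
      rw [e1, e2, mu_add, mu_add, rho_mul, rho_mul, mem_SS.1 hx, mem_SS.1 (neg_mem hx)]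
    · intro x _ y _ h
      simpa using h
  rw [← hM] at hle1 hge1
  have hMq : Fintype.card Ω = M * q0 := by
    have : Fintype.card F * M = Fintype.card Ω * s0 := le_antisymm hle1 hge1
    have hs0pos : 0 < s0 := by rcases Nat.eq_zero_or_pos s0 with h | h; (rw [h] at hsq; omega); exact h
    apply Nat.eq_of_mul_eq_mul_right hs0pos
    rw [← this, ← hsq]; ring
  have hMN : M ≤ Fintype.card Ω := by rw [hM, fx]; exact Finset.card_le_univ _
  -- fixed points of w t_a
  have hwt : ∀ a : Fˣ, fx ρ (mw * mt a) = M := by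
    intro a
    obtain ⟨g, hg⟩ := wt_conj h2 i hi2 a
    rw [hM, fx, fx, Finset.card_filter, Finset.card_filter, ← Equiv.sum_comp (ρ g)]
    apply Finset.sum_congr rfl
    intro ω _
    congr 1
    rw [← rho_mul, hg, rho_mul, EmbeddingLike.apply_eq_iff_eq]
  have hineq : ∑ a : Fˣ, fx ρ (mw * mt a) ≤ ∑ a : Fˣ, fx ρ (mt a) := by
    simp_rw [fx, Finset.card_filter]
    rw [Finset.sum_comm, Finset.sum_comm (s := (Finset.univ : Finset Fˣ)) (f := fun a ω => if ρ (mt a) ω = ω then 1 else 0)]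
    apply Finset.sum_le_sum
    intro ω _
    rw [← Finset.card_filter, ← Finset.card_filter]
    by_cases hx : ∃ a0 : Fˣ, ρ (mw * mt a0) ω = ω
    · obtain ⟨a0, h0⟩ := hx
      apply Finset.card_le_card_of_injOn (fun a => a0⁻¹ * a)
      · intro a ha
        simp only [Finset.coe_filter, Finset.mem_univ, true_and, Set.mem_setOf_eq] at ha ⊢
        rw [rho_mul] at ha h0
        have := (ρ mw).injective (ha.trans h0.symm)
        rw [mt_mul, rho_mul, this, ← rho_mul, ← mt_mul]
        simp [mt_one]
      · intro x _ y _ h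
        simpa using h
    · push Not at hx
      rw [Finset.filter_false_of_mem (fun x _ => hx x)]
      simp
  simp_rw [hwt] at hineq
  rw [Finset.sum_const, Finset.card_univ, Fintype.card_units, smul_eq_mul] at hineq
  obtain ⟨K, hK⟩ : ∃ K : Finset Fˣ, K = Finset.univ.filter (fun a : Fˣ => UU ψ ρ ω1 ((a : F) ^ 2 * c1)) := ⟨_, rfl⟩
  have hKcard : K.card ≤ 2 * (q0 - 1) := by
    have e : ((Finset.univ.filter (fun c => UU ψ ρ ω1 c)).erase 0).card = q0 - 1 := by
      rw [Finset.card_erase_of_mem, ← hq0]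
      simpa using UU_zero ω1
    rw [← e]
    apply Finset.card_le_mul_card_image_of_maps_to (f := fun a : Fˣ => (a : F) ^ 2 * c1)
    · intro a ha
      rw [hK, Finset.mem_filter_univ] at ha
      simp [hc1, ha]
    · intro b _
      by_cases hx : ∃ a0 : Fˣ, (a0 : F) ^ 2 * c1 = b
      · obtain ⟨a0, h0⟩ := hx
        refine (Finset.card_le_card ?_).trans (Finset.card_le_two (a := a0) (b := -a0))
        intro a ha
        rw [Finset.mem_filter, ← h0] at ha
        have := mul_right_cancel₀ hc1 ha.2
        rcases sq_eq_sq_iff_eq_or_eq_neg.1 this with h | h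
        · simp [Units.ext h]
        · have : a = -a0 := Units.ext (by simpa using h)
          simp [this]
      · push Not at hx
        rw [Finset.filter_false_of_mem (fun x _ => hx x)]
        simp
  have hbound : ∀ a : Fˣ, (fx ρ (mt a) : ℤ) ≤ (if a ∈ K then (M : ℤ) else 0) + (if a = 1 then (Fintype.card Ω : ℤ) - M else 0) + (if a = -1 then (Fintype.card Ω : ℤ) - M else 0) := by
    have hMN' : (M : ℤ) ≤ Fintype.card Ω := by exact_mod_cast hMN
    intro a
    have htriv : (fx ρ (mt a) : ℤ) ≤ Fintype.card Ω := by
      rw [fx]; exact_mod_cast Finset.card_le_univ _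
    have hun : (1 : Fˣ) ≠ -1 := by
      intro h
      apply h11
      have := congrArg Units.val h
      simpa using this.symm
    by_cases ha1 : a = 1
    · have : a ∈ K := by rw [hK, ha1]; simpa using hω1
      rw [if_pos this, if_pos ha1, if_neg (by rw [ha1]; exact hun)]
      linarith
    by_cases ha2 : a = -1
    · have : a ∈ K := by rw [hK, ha2]; simpa using hω1
      rw [if_pos this, if_neg ha1, if_pos ha2]
      linarith
    rw [if_neg ha1, if_neg ha2]
    have hasq : (a : F) ^ 2 ≠ 1 := by
      intro h
      rcases sq_eq_one_iff.1 h with h | h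
      · exact ha1 (Units.ext (by simpa using h))
      · exact ha2 (Units.ext (by simpa using h))
    by_cases haK : a ∈ K
    · rw [if_pos haK]
      have h3 := fx_le (ρ := ρ) hs hasq
      have h4 : Fintype.card F * fx ρ (mt a) ≤ Fintype.card F * M := h3.trans hge1
      have h5 := Nat.le_of_mul_le_mul_left h4 (by omega)
      simp
      exact_mod_cast h5
    · rw [if_neg haK]
      have : fx ρ (mt a) = 0 := by
        rw [fx, Finset.card_eq_zero, Finset.filter_eq_empty_iff]
        intro ω _ h
        apply haK
        rw [hK, Finset.mem_filter_univ]
        obtain ⟨s, hs'⟩ := hmove ω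
        obtain ⟨x, hx⟩ := hone _ hs'
        have e : UU ψ ρ (ρ (mt s) ω) ((a : F) ^ 2 * c1) := by
          rw [← UU_mt, ← rho_mul, ← mt_mul, mul_comm, mt_mul, rho_mul, h]
          exact hs'
        intro y hy
        rw [← hx, UU_orbit (ψ := ψ)] at hy
        exact e y hy
      rw [this]; simp
  have hsumb : ((Fintype.card F - 1 : ℕ) : ℤ) * M ≤ K.card * M + 2 * (Fintype.card Ω - M) := by
    have h1 : (((Fintype.card F - 1) * M : ℕ) : ℤ) ≤ ((∑ a : Fˣ, fx ρ (mt a) : ℕ) : ℤ) := by exact_mod_cast hineq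
    push_cast at h1 ⊢
    refine h1.trans ((Finset.sum_le_sum (fun a _ => hbound a)).trans ?_)
    rw [Finset.sum_add_distrib, Finset.sum_add_distrib]
    simp
    linarith
  -- arithmetic
  have hodd : Fintype.card F % 2 = 1 := FiniteField.odd_card_of_char_ne_two (ringChar_ne h2)
  have hs1 : s0 ≠ 1 := by
    intro h
    have : q0 = Fintype.card F := by rw [← hsq, h, one_mul]
    rw [hq0, ← Finset.card_univ] at this
    have h3 := Finset.eq_univ_of_card _ this
    have h4 : c0 ∈ Finset.univ.filter (fun c => UU ψ ρ ω1 c) := by rw [h3]; simp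
    rw [Finset.mem_filter_univ] at h4
    exact hU0 _ h4
  have hMpos : 0 < M := by
    rcases Nat.eq_zero_or_pos M with h | h
    · rw [h, zero_mul] at hMq; omega
    · exact h
  have hq0pos : 0 < q0 := by
    rcases Nat.eq_zero_or_pos q0 with h | h
    · rw [h, mul_zero] at hsq; omega
    · exact h
  obtain ⟨r, rfl⟩ : ∃ r, q0 = r + 1 := ⟨q0 - 1, by omega⟩
  rw [Nat.add_sub_cancel] at hKcard
  have hmain : Fintype.card F - 1 ≤ 4 * r := by
    have h1 : ((Fintype.card F - 1 : ℕ) : ℤ) * M ≤ (4 * r : ℤ) * M := by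
      have : (K.card : ℤ) * M ≤ (2 * r : ℤ) * M := by
        apply mul_le_mul_of_nonneg_right _ (by positivity)
        exact_mod_cast hKcard
      rw [hMq] at hsumb
      push_cast at hsumb ⊢
      nlinarith
    have := le_of_mul_le_mul_right h1 (by exact_mod_cast hMpos)
    exact_mod_cast this
  have hs3 : s0 = 3 := by
    have h3 : s0 % 2 = 1 := by
      rw [← hsq, Nat.mul_mod] at hodd
      rcases Nat.mod_two_eq_zero_or_one s0 with h | h
      · rw [h] at hodd; simp at hodd
      · exact h
    have : s0 < 5 := by
      by_contra hcon
      have : 5 * (r + 1) ≤ s0 * (r + 1) := Nat.mul_le_mul_right _ (by omega)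
      omega
    omega
  have hfin : 2 * M * r = 3 * r + 2 := by
    rw [hB0', hMq, ← hsq, hs3] at hcount
    have e : 3 * (r + 1) - 1 = 3 * r + 2 := by omega
    rw [e] at hcount
    have : (3 * (r + 1)) * (2 * M * r) = (3 * (r + 1)) * (3 * r + 2) := by nlinarith
    exact Nat.eq_of_mul_eq_mul_left (by omega) this
  have hdvd : r ∣ 2 := by
    have h1 : r ∣ 3 * r + 2 := ⟨2 * M, by rw [← hfin]; ring⟩
    exact (Nat.dvd_add_right (Dvd.intro_left 3 rfl)).1 h1
  have hr := Nat.le_of_dvd (by norm_num) hdvd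
  rw [hs3] at hsq
  interval_cases r <;> omega
end caseb3
end PSLMin

set_option linter.all false
namespace PSLMin
open Matrix


lemma exists_char (F : Type*) [Field F] [Fintype F] : ∃ ψ : AddChar F ℂ, ψ ≠ 1 := by
  refine ⟨AddChar.FiniteField.primitiveChar_to_Complex F, ?_⟩
  have h := AddChar.FiniteField.primitiveChar_to_Complex_isPrimitive F (one_ne_zero)
  rwa [AddChar.mulShift_one] at h

lemma exists_sub (n : ℕ) (hn : 2 ≤ n) (F : Type*) [Field F] [Fintype F] :
    ∃ H : Subgroup (Matrix.SpecialLinearGroup (Fin n) F ⧸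
        Subgroup.center (Matrix.SpecialLinearGroup (Fin n) F)),
      H ≠ ⊤ ∧ H.index = (Fintype.card F ^ n - 1) / (Fintype.card F - 1) := by
  have hne : Nontrivial (Fin n → F) := by
    haveI : Nonempty (Fin n) := ⟨⟨0, by omega⟩⟩
    infer_instance
  haveI : Nontrivial (Fin n) := Fin.nontrivial_iff_two_le.2 hn
  have hq : 1 < Fintype.card F := Fintype.one_lt_card
  obtain ⟨v, hv⟩ := exists_ne (0 : Fin n → F)
  let p : Projectivization F (Fin n → F) := Projectivization.mk F v hv
  let H := MulAction.stabilizer (Matrix.ProjectiveSpecialLinearGroup (Fin n) F) p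
  have hidx : H.index = Nat.card (Projectivization F (Fin n → F)) :=
    MulAction.index_stabilizer_of_transitive _ p
  have hcard : Nat.card (Projectivization F (Fin n → F)) = (Fintype.card F ^ n - 1) / (Fintype.card F - 1) := by
    rw [Projectivization.card'']
    simp [Nat.card_eq_fintype_card]
  refine ⟨H, ?_, hidx.trans hcard⟩
  intro htop
  have h1 : H.index = 1 := Subgroup.index_eq_one.2 htop
  have h2 : 2 ≤ (Fintype.card F ^ n - 1) / (Fintype.card F - 1) := by
    rw [Nat.le_div_iff_mul_le (by omega)]
    have : Fintype.card F ^ 2 ≤ Fintype.card F ^ n := Nat.pow_le_pow_right (by omega) hn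
    obtain ⟨k, hk⟩ : ∃ k, Fintype.card F = k + 2 := ⟨_, (Nat.sub_add_cancel hq).symm⟩
    rw [hk] at this ⊢
    have e : (k+2)^2 = k*k + 4*k + 4 := by ring
    rw [e] at this
    have := Nat.zero_le (k*k)
    omega
  have := hidx.trans hcard
  omega

lemma lower (n : ℕ) (hn : 2 ≤ n) (F : Type*) [Field F] [Fintype F]
    (hexc : (n, Fintype.card F) ∉
      ({(2, 2), (2, 3), (2, 5), (2, 7), (2, 9), (2, 11), (4, 2)} : Set (ℕ × ℕ)))
    (H : Subgroup (Matrix.SpecialLinearGroup (Fin n) F ⧸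
        Subgroup.center (Matrix.SpecialLinearGroup (Fin n) F))) (hH : H ≠ ⊤) :
    (Fintype.card F ^ n - 1) / (Fintype.card F - 1) ≤ H.index := by
  classical
  have hq : 1 < Fintype.card F := Fintype.one_lt_card
  obtain ⟨ψ, hψ⟩ := exists_char F
  let G := SL n F
  let K : Subgroup G := H.comap (QuotientGroup.mk' _)
  have hKi : K.index = H.index :=
    Subgroup.index_comap_of_surjective H (QuotientGroup.mk'_surjective _)
  let Ω := G ⧸ K
  letI : Fintype Ω := Fintype.ofFinite _
  have hc : Fintype.card Ω = H.index := by
    rw [← hKi, Subgroup.index_eq_card, Nat.card_eq_fintype_card]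
  let ρ : SL n F →* Equiv.Perm Ω := MulAction.toPermHom G Ω
  have htr : ∀ ω ω' : Ω, ∃ g, ρ g ω = ω' := fun ω ω' => MulAction.exists_smul_eq G ω ω'
  haveI : Nonempty Ω := ⟨((1 : G) : Ω)⟩
  have hN2 : 2 ≤ Fintype.card Ω := by
    have h1 : H.index ≠ 1 := fun h => hH (Subgroup.index_eq_one.1 h)
    have h0 : 0 < Fintype.card Ω := Fintype.card_pos
    omega
  have hcen : ∀ z ∈ Subgroup.center G, ∀ ω : Ω, ρ z ω = ω := by
    intro z hz ω
    induction ω using QuotientGroup.induction_on with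
    | H g =>
      change (((z * g : G)) : Ω) = (g : Ω)
      rw [← (Subgroup.mem_center_iff.1 hz g)]
      symm
      rw [QuotientGroup.eq]
      change QuotientGroup.mk' _ (g⁻¹ * (g * z)) ∈ H
      rw [inv_mul_cancel_left]
      have : QuotientGroup.mk' (Subgroup.center G) z = 1 := (QuotientGroup.eq_one_iff z).2 hz
      rw [this]
      exact H.one_mem
  by_contra hlt
  push Not at hlt
  rw [← hc] at hlt
  have h1 : (Fintype.card Ω + 1) * (Fintype.card F - 1) ≤ Fintype.card F ^ n - 1 :=
    (Nat.le_div_iff_mul_le (by omega)).1 hlt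
  have hN : Fintype.card Ω * (Fintype.card F - 1) + Fintype.card F ≤ Fintype.card F ^ n := by
    rw [Nat.add_mul, one_mul] at h1
    omega
  rcases Nat.lt_or_ge 2 n with h3 | h3
  · obtain ⟨R1, R2⟩ := regular (ρ := ρ) h3 hψ htr hN2 hN
    refine nine (ρ := ρ) h3 ?_ R1 R2
    rintro ⟨a, b⟩
    apply hexc
    simp [a, b]
  · obtain rfl : n = 2 := by omega
    simp only [Set.mem_insert_iff, Set.mem_singleton_iff, Prod.mk.injEq, true_and, not_or] at hexc
    obtain ⟨e2, e3, e5, e7, e9, e11, -⟩ := hexc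
    have hneg : ∀ ω : Ω, ρ (-1) ω = ω := by
      apply hcen
      rw [Subgroup.mem_center_iff]
      intro g
      exact (mul_neg_one g).trans (neg_one_mul g).symm
    have hN' : Fintype.card Ω ≤ Fintype.card F := by
      obtain ⟨k, hk⟩ : ∃ k, Fintype.card F = k + 2 := ⟨_, (Nat.sub_add_cancel hq).symm⟩
      rw [hk] at hN ⊢
      simp only [Nat.add_succ_sub_one] at hN
      by_contra hh
      have hh' : k + 3 ≤ Fintype.card Ω := by omega
      nlinarith [Nat.mul_le_mul_right (k+1) hh']
    rcases dich (ρ := ρ) hψ htr hN2 hneg hN' with ⟨R1, R2⟩ | ⟨h2, c1, c0, a1, a2, a3, a4, a5, a6⟩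
    · exact case_a (ρ := ρ) (by omega) e5 e7 e11 hneg R1 R2
    · exact case_b (ρ := ρ) hψ htr hN2 hneg hN' e9 h2 a1 a2 a3 a4 a5 a6

end PSLMin

/-- For `n ≥ 2` and a finite field `F` with `|F| = q`, excluding
`(n,q) ∈ {(2,2),(2,3),(2,5),(2,7),(2,9),(2,11),(4,2)}`, every proper subgroup of
`PSL_n(F)` has index at least `(q^n - 1)/(q - 1)`; that is, the minimal degree of
a faithful permutation representation of `PSL_n(F)` is `(q^n - 1)/(q - 1)`. -/
theorem minimal_degree_PSL (n : ℕ) (hn : 2 ≤ n) (F : Type*) [Field F] [Fintype F]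
    (hexc : (n, Fintype.card F) ∉
      ({(2, 2), (2, 3), (2, 5), (2, 7), (2, 9), (2, 11), (4, 2)} : Set (ℕ × ℕ))) :
    (∀ H : Subgroup (Matrix.SpecialLinearGroup (Fin n) F ⧸
        Subgroup.center (Matrix.SpecialLinearGroup (Fin n) F)),
      H ≠ ⊤ → (Fintype.card F ^ n - 1) / (Fintype.card F - 1) ≤ H.index) ∧
    ∃ H : Subgroup (Matrix.SpecialLinearGroup (Fin n) F ⧸
        Subgroup.center (Matrix.SpecialLinearGroup (Fin n) F)),
      H ≠ ⊤ ∧ H.index = (Fintype.card F ^ n - 1) / (Fintype.card F - 1) := by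
  exact ⟨PSLMin.lower n hn F hexc, PSLMin.exists_sub n hn F⟩
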